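/- Let d ∈ ℕ, τ ≥ d+1, α ∈ (0,1), and n ≥ τ⁴. Let n̂ ∈ n S_d^o be a vector of observed counts with p̂_n := n̂/n ∈ P_τ. Define C(p̂_n, α) := { p ∈ S_d^o : Σ_{k : P_{n,p}(k) ≥ P_{n,p}(n̂)} P_{n,p}(k) ≤ 1 − α } and C̃(p̂_n, α) := { p ∈ S_d^o : γ̄(d/2, δ_{n̂,p}ᵀ Σ_p^{−1} δ_{n̂,p} / 2) ≤ 1 − α }. Then C(p̂_n, α) ⊆ C̃(p̂_n, α − ε_n), with ε_n := 194.96 τ³ (d+1) (log n)^{3/2} / n^{1/2}. -/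

import Mathlib

open MeasureTheory Matrix Real Finset
open scoped BigOperators ENNReal NNReal

noncomputable section

/-- Extended probability vector: `p` on `Fin d`, together with `p (d+1) = 1 - ∑ p`. -/
def extP (d : ℕ) (p : Fin d → ℝ) : Fin (d + 1) → ℝ :=
  Fin.snoc p (1 - ∑ i, p i)

/-- Extended coordinate vector: `v` on `Fin d`, together with `v (d+1) = n - ∑ v`. -/
def extV (d n : ℕ) (v : Fin d → ℝ) : Fin (d + 1) → ℝ :=
  Fin.snoc v ((n : ℝ) - ∑ i, v i)

/-- `δ_{y,q} = (y - n q) / √n`. -/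
def del (n : ℕ) (q y : ℝ) : ℝ := (y - n * q) / Real.sqrt n

/-- The vector `δ_{v,p}`. -/
def delVec (d n : ℕ) (p v : Fin d → ℝ) : Fin d → ℝ := fun i => del n (p i) (v i)

/-- The covariance matrix `Σ_p = diag p - p pᵀ`. -/
def covM (d : ℕ) (p : Fin d → ℝ) : Matrix (Fin d) (Fin d) ℝ :=
  Matrix.diagonal p - Matrix.vecMulVec p p

/-- The quadratic form `x ↦ xᵀ Σ_p⁻¹ x`. -/
def quadForm (d : ℕ) (p x : Fin d → ℝ) : ℝ := x ⬝ᵥ ((covM d p)⁻¹ *ᵥ x)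

/-- The Gaussian density `φ_{Σ_p}`. -/
def gaussDens (d : ℕ) (p y : Fin d → ℝ) : ℝ :=
  Real.exp (-(1 / 2) * quadForm d p y) /
    Real.sqrt ((2 * Real.pi) ^ d * ∏ i, extP d p i)

/-- The `Multinomial(n, p)` probability mass function. -/
def multinomialPMF (d n : ℕ) (p : Fin d → ℝ) (k : Fin d → ℕ) : ℝ :=
  if ∑ i, k i ≤ n then
    ((n.factorial : ℝ) / ((∏ i, ((k i).factorial : ℝ)) * ((n - ∑ i, k i).factorial : ℝ))) *
      ((∏ i, p i ^ k i) * (1 - ∑ i, p i) ^ (n - ∑ i, k i))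
  else 0

/-- The interior `S_d^o` of the unit simplex. -/
def simplexInt (d : ℕ) : Set (Fin d → ℝ) :=
  {s | (∀ i, s i ∈ Set.Ioo (0 : ℝ) 1) ∧ ∑ i, s i < 1}

/-- The set `P_τ`. -/
def Ptau (d : ℕ) (τ : ℝ) : Set (Fin d → ℝ) :=
  {s | s ∈ simplexInt d ∧ ∀ i : Fin (d + 1), (extP d s i)⁻¹ ≤ τ}

/-- Cast a vector of naturals to a real vector. -/
def castK (d : ℕ) (k : Fin d → ℕ) : Fin d → ℝ := fun i => (k i : ℝ)

/-- The bulk set `B_{n,p}` (integer vectors). -/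
def bulk (d n : ℕ) (τ : ℝ) (p : Fin d → ℝ) : Set (Fin d → ℕ) :=
  {k | (∀ i, 0 < k i) ∧ ∑ i, k i < n ∧
    ∀ i : Fin (d + 1),
      |del n (extP d p i) (extV d n (castK d k) i) / (Real.sqrt n * extP d p i)| ≤
        τ * Real.sqrt (Real.log n / n)}

/-- The bulk set `B_{n,p}` (real vectors). -/
def bulkReal (d n : ℕ) (τ : ℝ) (p : Fin d → ℝ) : Set (Fin d → ℝ) :=
  {x | ∀ i : Fin (d + 1),
    |del n (extP d p i) (extV d n x i) / (Real.sqrt n * extP d p i)| ≤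
      τ * Real.sqrt (Real.log n / n)}

/-- The main term in the local expansion. -/
def mainTerm (d n : ℕ) (p v : Fin d → ℝ) : ℝ :=
  (n : ℝ) ^ (-(1 : ℝ) / 2) * ∑ i : Fin (d + 1),
    (del n (extP d p i) (extV d n v i) ^ 3 / (6 * extP d p i ^ 2) -
      del n (extP d p i) (extV d n v i) / (2 * extP d p i))

/-- The bound on the remainder `R_{n,p}(k)`. -/
def errBound (d n : ℕ) (τ : ℝ) (p v : Fin d → ℝ) : ℝ :=
  (n : ℝ)⁻¹ * ∑ i : Fin (d + 1),
    (21 * |del n (extP d p i) (extV d n v i)| ^ 4 / extP d p i ^ 3 +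
      10 * |del n (extP d p i) (extV d n v i)| ^ 2 / extP d p i ^ 2 + 2 * τ / 3)

/-- The log-ratio of the multinomial pmf over the corresponding normal density. -/
def logRatio (d n : ℕ) (p : Fin d → ℝ) (k : Fin d → ℕ) : ℝ :=
  Real.log (multinomialPMF d n p k /
    ((n : ℝ) ^ (-(d : ℝ) / 2) * gaussDens d p (delVec d n p (castK d k))))

/-- The law of a `Multinomial(n,p)` random vector, as a measure on `ℝ^d`. -/
def multinomialLaw (d n : ℕ) (p : Fin d → ℝ) : Measure (Fin d → ℝ) :=
  Measure.sum fun k : Fin d → ℕ =>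
    ENNReal.ofReal (multinomialPMF d n p k) • Measure.dirac (castK d k)

/-- The law of a `Uniform(-1/2,1/2)^d` random vector. -/
def uniformBoxLaw (d : ℕ) : Measure (Fin d → ℝ) :=
  volume.restrict (Set.univ.pi fun _ : Fin d => Set.Ioo (-(1 : ℝ) / 2) (1 / 2))

/-- The law of a `Normal_d (n p, n Σ_p)` random vector. -/
def gaussLaw (d n : ℕ) (p : Fin d → ℝ) : Measure (Fin d → ℝ) :=
  volume.withDensity fun y =>
    ENNReal.ofReal ((n : ℝ) ^ (-(d : ℝ) / 2) * gaussDens d p (delVec d n p y))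

/-- The regularized lower incomplete gamma function `γ̄(x, a)`. -/
def regGamma (x a : ℝ) : ℝ :=
  (∫ t in (0 : ℝ)..a, t ^ (x - 1) * Real.exp (-t)) / Real.Gamma x

/-- The sum `∑_{k : P_{n,p}(k) ≥ P_{n,p}(n̂)} P_{n,p}(k)`. -/
def confSum (d n : ℕ) (p : Fin d → ℝ) (nh : Fin d → ℕ) : ℝ :=
  ∑' k : Fin d → ℕ,
    Set.indicator {k' : Fin d → ℕ | multinomialPMF d n p nh ≤ multinomialPMF d n p k'}
      (multinomialPMF d n p) k

/-- The exact multinomial confidence set `C(p̂_n, α)`. -/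
def exactCS (d n : ℕ) (nh : Fin d → ℕ) (α : ℝ) : Set (Fin d → ℝ) :=
  {p | p ∈ simplexInt d ∧ confSum d n p nh ≤ 1 - α}

/-- The Gaussian confidence set `C̃(p̂_n, α)`. -/
def gaussCS (d n : ℕ) (nh : Fin d → ℕ) (α : ℝ) : Set (Fin d → ℝ) :=
  {p | p ∈ simplexInt d ∧
    regGamma ((d : ℝ) / 2) (quadForm d p (delVec d n p (castK d nh)) / 2) ≤ 1 - α}

/-- Error term in Stirling's formula. -/
lemma log_factorial_stirling_bounds {m : ℕ} (hm : m ≠ 0) :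
    ∃ θ : ℝ, 0 ≤ θ ∧ θ ≤ 1 / (12 * m) ∧
      Real.log (m.factorial : ℝ) =
        m * Real.log m - m + Real.log m / 2 + Real.log (2 * π) / 2 + θ := by
  have step : ∀ k : ℕ, Real.log (Stirling.stirlingSeq (k + 1)) - 1 / (12 * ((k : ℝ) + 1)) ≤
      Real.log (√π) := by
    intro k
    have hmono : Monotone fun k : ℕ =>
        Real.log (Stirling.stirlingSeq (k + 1)) - 1 / (12 * ((k : ℝ) + 1)) := by
      refine monotone_nat_of_le_succ fun k => ?_
      have h := Stirling.log_stirlingSeq_sdiff_le (k + 1)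
      push_cast at h
      have e : 1 / (12 * ((k : ℝ) + 1)) - 1 / (12 * ((k : ℝ) + 1 + 1)) =
          1 / (12 * ((k : ℝ) + 1) * (k + 1 + 1)) := by
        field_simp; ring
      push_cast
      linarith
    have hlim : Filter.Tendsto (fun k : ℕ =>
        Real.log (Stirling.stirlingSeq (k + 1)) - 1 / (12 * ((k : ℝ) + 1))) Filter.atTop
        (nhds (Real.log (√π) - 0)) := by
      refine Filter.Tendsto.sub ?_ ?_
      · exact ((Real.continuousAt_log (by positivity)).tendsto.comp
          (Stirling.tendsto_stirlingSeq_sqrt_pi.comp (Filter.tendsto_add_atTop_nat 1)))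
      · have := (tendsto_one_div_add_atTop_nhds_zero_nat (𝕜 := ℝ)).const_mul (1 / 12)
        refine (this.congr fun k => ?_).trans (by simp)
        field_simp
    simpa using hmono.ge_of_tendsto hlim k
  obtain ⟨k, rfl⟩ := Nat.exists_eq_succ_of_ne_zero hm
  have hlow := Stirling.le_log_factorial_stirling hm
  have hup := step k
  have hf := Stirling.log_stirlingSeq_formula (k + 1)
  refine ⟨_, sub_nonneg.2 hlow, ?_, by ring⟩
  have e1 : Real.log (√π) = Real.log π / 2 := Real.log_sqrt pi_pos.le
  have e2 : Real.log (2 * π) = Real.log 2 + Real.log π :=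
    Real.log_mul (by norm_num) pi_pos.ne'
  have hk : ((k + 1 : ℕ) : ℝ) ≠ 0 := by positivity
  rw [Real.log_mul (by norm_num) hk, Real.log_div hk (Real.exp_pos 1).ne', Real.log_exp] at hf
  rw [Nat.succ_eq_add_one] at *
  rw [hf, e1] at hup
  rw [e2]
  push_cast at *
  linarith

lemma regGamma_zero_left (a : ℝ) : regGamma 0 a = 0 := by simp [regGamma]

lemma gammaIntegrand_integrableOn {x : ℝ} (hx : 0 < x) :
    IntegrableOn (fun t : ℝ => t ^ (x - 1) * Real.exp (-t)) (Set.Ioi 0) := by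
  simpa [mul_comm] using Real.GammaIntegral_convergent hx

lemma regGamma_le_one {x a : ℝ} (hx : 0 < x) (ha : 0 ≤ a) : regGamma x a ≤ 1 := by
  unfold regGamma
  rw [div_le_one (Real.Gamma_pos_of_pos hx), intervalIntegral.integral_of_le ha,
    Real.Gamma_eq_integral hx]
  simp_rw [mul_comm (Real.exp _)]
  refine setIntegral_mono_set (gammaIntegrand_integrableOn hx) ?_ ?_
  · filter_upwards [ae_restrict_mem measurableSet_Ioi] with t ht
    have : (0 : ℝ) < t := ht
    positivity
  · exact Filter.Eventually.of_forall fun t ht => ht.1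

/-- The normalising constant of the chi density. -/
def chiConst (d : ℕ) : ℝ := 2 / (2 ^ ((d : ℝ) / 2) * Real.Gamma ((d : ℝ) / 2))

lemma chiConst_pos {d : ℕ} (hd : 0 < d) : 0 < chiConst d := by
  have : 0 < Real.Gamma ((d : ℝ) / 2) := Real.Gamma_pos_of_pos (by positivity)
  unfold chiConst; positivity

/-- `γ̄(d/2, r²/2)` is the distribution function of the chi law. -/
lemma regGamma_half_sq {d : ℕ} (hd : 0 < d) {r : ℝ} (hr : 0 ≤ r) :
    regGamma ((d : ℝ) / 2) (r ^ 2 / 2) =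
      chiConst d * ∫ y in (0 : ℝ)..r, y ^ (d - 1) * Real.exp (-(y ^ 2 / 2)) := by
  have key := intervalIntegral.integral_comp_mul_deriv_of_deriv_nonneg (a := 0) (b := r)
    (f := fun y : ℝ => y ^ 2 / 2) (f' := fun y => y)
    (g := fun t : ℝ => t ^ ((d : ℝ) / 2 - 1) * Real.exp (-t)) (by fun_prop)
    (fun y _ => by
      have := ((hasDerivAt_id y).pow 2).div_const 2
      simpa using this)
    (fun y hy => by rw [min_eq_left hr] at hy; exact hy.1.le)
  simp only [Function.comp_def] at key
  unfold regGamma chiConst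
  have h0 : (0 : ℝ) ^ 2 / 2 = 0 := by norm_num
  rw [h0] at key
  rw [← key]
  have e : ∫ y in (0 : ℝ)..r, (y ^ 2 / 2) ^ ((d : ℝ) / 2 - 1) * Real.exp (-(y ^ 2 / 2)) * y =
      (2 / 2 ^ ((d : ℝ) / 2)) * ∫ y in (0 : ℝ)..r, y ^ (d - 1) * Real.exp (-(y ^ 2 / 2)) := by
    rw [← intervalIntegral.integral_const_mul]
    refine intervalIntegral.integral_congr_ae (Filter.Eventually.of_forall fun y hy => ?_)
    rw [Set.uIoc_of_le hr] at hy
    have hy0 : 0 < y := hy.1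
    have h1 : (y ^ 2 / 2) ^ ((d : ℝ) / 2 - 1) * y = 2 / 2 ^ ((d : ℝ) / 2) * y ^ (d - 1) := by
      rw [Real.div_rpow (by positivity) (by norm_num), Real.rpow_sub_one (x := 2) (by norm_num),
        ← Real.rpow_natCast y 2, ← Real.rpow_mul hy0.le, ← Real.rpow_natCast y (d - 1),
        Nat.cast_pred hd]
      have : ((2 : ℕ) : ℝ) * ((d : ℝ) / 2 - 1) = (d : ℝ) - 1 - 1 := by push_cast; ring
      rw [this, Real.rpow_sub_one hy0.ne' ((d : ℝ) - 1)]
      field_simp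
    linear_combination Real.exp (-(y ^ 2 / 2)) * h1
  rw [e]
  field_simp

/-- The unnormalised chi density at a point is at most twice its value near the mode. -/
lemma chi_le_two_mul_near_mode {m : ℕ} {y v : ℝ} (hy : 0 ≤ y) (hv : √m ≤ v)
    (hv' : v ≤ √m + 1 / 2) :
    y ^ m * Real.exp (-(y ^ 2 / 2)) ≤ 2 * (v ^ m * Real.exp (-(v ^ 2 / 2))) := by
  have he : Real.exp (1 / 2) ≤ 2 := by
    have h2 := Real.exp_one_lt_d9
    have : Real.exp (1 / 2) ^ 2 = Real.exp 1 := by rw [← Real.exp_nat_mul]; norm_num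
    nlinarith [Real.exp_pos (1 / 2)]
  suffices h : y ^ m * Real.exp (-(y ^ 2 / 2)) ≤
      Real.exp (1 / 2) * (v ^ m * Real.exp (-(v ^ 2 / 2))) by
    have hv0 : 0 ≤ v := (Real.sqrt_nonneg _).trans hv
    refine h.trans (mul_le_mul_of_nonneg_right he (by positivity))
  rcases Nat.eq_zero_or_pos m with rfl | hm
  · simp only [Nat.cast_zero, Real.sqrt_zero, zero_add, pow_zero, one_mul] at *
    rw [← Real.exp_add]
    exact Real.exp_le_exp.2 (by nlinarith [sq_nonneg y])
  have hm' : (0 : ℝ) < m := by exact_mod_cast hm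
  set μ := √(m : ℝ) with hμ
  have hμ0 : 0 < μ := Real.sqrt_pos.2 hm'
  have hμ2 : μ ^ 2 = m := Real.sq_sqrt hm'.le
  have hv0 : 0 < v := hμ0.trans_le hv
  rcases hy.eq_or_lt with rfl | hy0
  · rw [zero_pow hm.ne', zero_mul]; positivity
  have ex : ∀ z : ℝ, 0 < z → z ^ m * Real.exp (-(z ^ 2 / 2)) =
      Real.exp (m * Real.log z - z ^ 2 / 2) := by
    intro z hz
    rw [sub_eq_add_neg, Real.exp_add, Real.exp_nat_mul, Real.exp_log hz]
  rw [ex y hy0, ex v hv0, ← Real.exp_add, Real.exp_le_exp]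
  have l1 : Real.log ((y / μ) ^ 2) ≤ (y / μ) ^ 2 - 1 := Real.log_le_sub_one_of_pos (by positivity)
  have l2 : Real.log ((μ / v) ^ 2) ≤ (μ / v) ^ 2 - 1 := Real.log_le_sub_one_of_pos (by positivity)
  rw [Real.log_pow, Real.log_div (by positivity) (by positivity)] at l1 l2
  push_cast at l1 l2
  have a1 : μ ^ 2 * (y / μ) ^ 2 = y ^ 2 := by field_simp
  have a2 : μ ^ 2 * (μ / v) ^ 2 ≤ 1 + μ ^ 2 - (v ^ 2 - μ ^ 2) := by
    have : μ ^ 2 * (μ / v) ^ 2 = μ ^ 4 / v ^ 2 := by field_simp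
    rw [this, div_le_iff₀ (by positivity)]
    obtain ⟨h, rfl⟩ : ∃ h, v = μ + h := ⟨v - μ, by ring⟩
    have hh : 0 ≤ h := by linarith
    have hh' : h ≤ 1 / 2 := by linarith
    have : (h * (2 * μ + h)) ^ 2 ≤ (μ + h) ^ 2 := by
      apply pow_le_pow_left₀ (by positivity)
      nlinarith
    nlinarith
  rw [← hμ2]
  have b1 := mul_le_mul_of_nonneg_left l1 (sq_nonneg μ)
  have b2 := mul_le_mul_of_nonneg_left l2 (sq_nonneg μ)
  nlinarith

/-- The chi distribution function is Lipschitz. -/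
lemma regGamma_half_sq_sub_le {d : ℕ} (hd : 0 < d) {r s : ℝ} (hs : 0 ≤ s) (hsr : s ≤ r) :
    regGamma ((d : ℝ) / 2) (r ^ 2 / 2) - regGamma ((d : ℝ) / 2) (s ^ 2 / 2) ≤ 4 * (r - s) := by
  set f : ℝ → ℝ := fun y => y ^ (d - 1) * Real.exp (-(y ^ 2 / 2)) with hf
  have hfc : Continuous f := by fun_prop
  have hfi : ∀ a b, IntervalIntegrable f volume a b := fun a b => hfc.intervalIntegrable a b
  have hc := chiConst_pos hd
  set μ := √((d - 1 : ℕ) : ℝ) with hμ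
  have hμ0 : 0 ≤ μ := Real.sqrt_nonneg _
  have hbound : ∀ y, 0 ≤ y → chiConst d * f y ≤ 4 := by
    intro y hy
    have h1 : ∫ v in μ..(μ + 1 / 2), f y / 2 ≤ ∫ v in μ..(μ + 1 / 2), f v := by
      refine intervalIntegral.integral_mono_on (by linarith) (by simp) (hfi _ _) fun v hv => ?_
      have := chi_le_two_mul_near_mode (m := d - 1) hy hv.1 hv.2
      simp only [hf]; linarith
    rw [intervalIntegral.integral_const] at h1
    have h2 : ∫ v in μ..(μ + 1 / 2), f v ≤ ∫ v in (0 : ℝ)..(μ + 1 / 2), f v := by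
      rw [← intervalIntegral.integral_add_adjacent_intervals (hfi 0 μ) (hfi μ _)]
      have : 0 ≤ ∫ v in (0 : ℝ)..μ, f v :=
        intervalIntegral.integral_nonneg hμ0 fun v hv => by
          have := hv.1
          simp only [hf]; positivity
      linarith
    have h3 := regGamma_half_sq hd (r := μ + 1 / 2) (by positivity)
    have h4 := regGamma_le_one (x := (d : ℝ) / 2) (a := (μ + 1 / 2) ^ 2 / 2) (by positivity)
      (by positivity)
    rw [h3] at h4
    have h5 := mul_le_mul_of_nonneg_left (h1.trans h2) hc.le
    simp only [smul_eq_mul] at h5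
    nlinarith
  rw [regGamma_half_sq hd hs, regGamma_half_sq hd (hs.trans hsr), ← mul_sub,
    intervalIntegral.integral_interval_sub_left (hfi _ _) (hfi _ _),
    ← intervalIntegral.integral_const_mul]
  calc _ ≤ ∫ y in s..r, (4 : ℝ) :=
        intervalIntegral.integral_mono_on hsr ((hfc.const_mul _).intervalIntegrable _ _) (by simp)
          fun y hy => hbound y (hs.trans hy.1)
    _ = _ := by rw [intervalIntegral.integral_const, smul_eq_mul, mul_comm]

lemma extP_pos {d : ℕ} {p : Fin d → ℝ} (hp : p ∈ simplexInt d) (i : Fin (d + 1)) :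
    0 < extP d p i := by
  refine Fin.lastCases ?_ (fun j => ?_) i
  · simpa [extP] using hp.2
  · simpa [extP] using (hp.1 j).1

lemma sum_extP (d : ℕ) (p : Fin d → ℝ) : ∑ i, extP d p i = 1 := by
  simp [extP, Fin.sum_univ_castSucc]

lemma prod_extP (d : ℕ) (p : Fin d → ℝ) :
    ∏ i, extP d p i = (∏ i, p i) * (1 - ∑ i, p i) := by
  simp [extP, Fin.prod_univ_castSucc]

/-- The inverse of `Σ_p` in closed form. -/
def precM (d : ℕ) (p : Fin d → ℝ) : Matrix (Fin d) (Fin d) ℝ :=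
  Matrix.diagonal (fun i => (p i)⁻¹) + Matrix.vecMulVec (fun _ => (1 - ∑ i, p i)⁻¹) (fun _ => 1)

lemma covM_mul_precM {d : ℕ} {p : Fin d → ℝ} (hp : p ∈ simplexInt d) :
    covM d p * precM d p = 1 := by
  have hq : 1 - ∑ i, p i ≠ 0 := (sub_pos.2 hp.2).ne'
  ext i j
  have hpi : ∀ i, p i ≠ 0 := fun i => (hp.1 i).1.ne'
  have h1 : ∑ k, p i * p k * (1 - ∑ i, p i)⁻¹ = p i * (∑ k, p k) * (1 - ∑ i, p i)⁻¹ := by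
    rw [Finset.mul_sum, Finset.sum_mul]
  simp only [covM, precM, Matrix.sub_mul, Matrix.mul_add, Matrix.sub_apply, Matrix.add_apply,
    Matrix.diagonal_mul_diagonal, Matrix.diagonal_mul, Matrix.mul_diagonal, Matrix.vecMulVec_apply,
    Matrix.mul_apply (M := Matrix.vecMulVec p p) (N := Matrix.vecMulVec _ _), mul_one, h1]
  rcases eq_or_ne i j with rfl | hij
  · simp only [Matrix.diagonal_apply_eq, Matrix.one_apply_eq]
    field_simp [hpi i]
    ring
  · simp only [Matrix.diagonal_apply_ne _ hij, Matrix.one_apply_ne hij]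
    field_simp [hpi j]
    ring

lemma covM_inv {d : ℕ} {p : Fin d → ℝ} (hp : p ∈ simplexInt d) : (covM d p)⁻¹ = precM d p :=
  Matrix.inv_eq_right_inv (covM_mul_precM hp)

lemma dotProduct_precM (d : ℕ) (p x : Fin d → ℝ) :
    x ⬝ᵥ (precM d p *ᵥ x) = ∑ i, x i ^ 2 / p i + (∑ i, x i) ^ 2 / (1 - ∑ i, p i) := by
  simp only [precM, Matrix.add_mulVec, dotProduct_add]
  congr 1
  · simp only [dotProduct, Matrix.mulVec_diagonal]
    refine Finset.sum_congr rfl fun i _ => ?_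
    ring
  · simp only [Matrix.vecMulVec, Matrix.mulVec, dotProduct, Matrix.of_apply, mul_one]
    simp only [← Finset.mul_sum, ← Finset.sum_mul]
    ring

/-- `δᵀ Σ_p⁻¹ δ` is Pearson's chi-square statistic. -/
lemma quadForm_delVec {d n : ℕ} (hn : 0 < n) {p : Fin d → ℝ} (hp : p ∈ simplexInt d)
    (y : Fin d → ℝ) :
    quadForm d p (delVec d n p y) =
      ∑ i, (extV d n y i - n * extP d p i) ^ 2 / (n * extP d p i) := by
  have hn' : (0 : ℝ) < n := by exact_mod_cast hn
  rw [quadForm, covM_inv hp, dotProduct_precM, Fin.sum_univ_castSucc]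
  have hs : √(n : ℝ) ^ 2 = n := Real.sq_sqrt hn'.le
  congr 1
  · refine Finset.sum_congr rfl fun i _ => ?_
    simp only [delVec, del, extV, extP, Fin.snoc_castSucc, div_pow, hs, div_div]
  · simp only [delVec, del, extV, extP, Fin.snoc_last, ← Finset.sum_div, div_pow, hs, div_div,
      Finset.sum_sub_distrib, ← Finset.mul_sum]
    congr 1
    ring

lemma det_precM {d : ℕ} {p : Fin d → ℝ} (hp : p ∈ simplexInt d) :
    (precM d p).det = (∏ i, extP d p i)⁻¹ := by
  have hq : 1 - ∑ i, p i ≠ 0 := (sub_pos.2 hp.2).ne'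
  have hpi : ∀ i, p i ≠ 0 := fun i => (hp.1 i).1.ne'
  have hdet : (Matrix.diagonal fun i => (p i)⁻¹).det ≠ 0 := by
    rw [Matrix.det_diagonal]
    exact Finset.prod_ne_zero_iff.2 fun i _ => inv_ne_zero (hpi i)
  have hinv : (Matrix.diagonal fun i => (p i)⁻¹)⁻¹ = Matrix.diagonal p := by
    apply Matrix.inv_eq_right_inv
    rw [Matrix.diagonal_mul_diagonal]
    simp [hpi]
  have hu : (∏ i, p i) ≠ 0 := Finset.prod_ne_zero_iff.2 fun i _ => hpi i
  rw [precM, Matrix.vecMulVec_eq Unit,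
    Matrix.det_add_replicateCol_mul_replicateRow (isUnit_iff_ne_zero.2 hdet), hinv,
    Matrix.det_diagonal, Matrix.det_unique, prod_extP, Finset.prod_inv_distrib]
  have : (1 + Matrix.replicateRow Unit (fun _ : Fin d => (1 : ℝ)) * Matrix.diagonal p *
      Matrix.replicateCol Unit (fun _ : Fin d => (1 - ∑ i, p i)⁻¹) : Matrix Unit Unit ℝ) default default =
      (1 - ∑ i, p i)⁻¹ := by
    rw [Matrix.add_apply, Matrix.one_apply_eq, Matrix.mul_apply]
    simp only [Matrix.mul_diagonal, Matrix.replicateRow_apply, Matrix.replicateCol_apply, one_mul,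
      ← Finset.sum_mul]
    field_simp
    ring
  rw [this, mul_inv]

open scoped MatrixOrder Matrix.Norms.L2Operator in
/-- A square root of `Σ_p⁻¹`. -/
lemma exists_precM_factor {d : ℕ} {p : Fin d → ℝ} (hp : p ∈ simplexInt d) :
    ∃ B : Matrix (Fin d) (Fin d) ℝ, precM d p = Bᵀ * B := by
  have hpsd : (precM d p).PosSemidef := by
    rw [Matrix.posSemidef_iff_dotProduct_mulVec]
    refine ⟨?_, fun x => ?_⟩
    · ext i j
      simp only [precM, Matrix.conjTranspose_apply, Matrix.add_apply, Matrix.vecMulVec_apply,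
        star_trivial, Matrix.diagonal_apply]
      rcases eq_or_ne i j with rfl | hij
      · rfl
      · simp [hij, hij.symm]
    · rw [star_trivial, dotProduct_precM]
      have := sub_pos.2 hp.2
      have h2 : ∀ i, 0 < p i := fun i => (hp.1 i).1
      have : 0 ≤ ∑ i, x i ^ 2 / p i :=
        Finset.sum_nonneg fun i _ => div_nonneg (sq_nonneg _) (h2 i).le
      positivity
  obtain ⟨B, hB⟩ := CStarAlgebra.nonneg_iff_eq_star_mul_self.mp hpsd.nonneg
  refine ⟨B, ?_⟩
  rw [hB, Matrix.star_eq_conjTranspose, Matrix.conjTranspose_eq_transpose_of_trivial]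

lemma quadForm_eq_norm_sq {d : ℕ} {p : Fin d → ℝ} (hp : p ∈ simplexInt d)
    {B : Matrix (Fin d) (Fin d) ℝ} (hB : precM d p = Bᵀ * B) (x : Fin d → ℝ) :
    quadForm d p x = ‖WithLp.toLp 2 (B *ᵥ x)‖ ^ 2 := by
  rw [quadForm, covM_inv hp, hB, ← Matrix.mulVec_mulVec, Matrix.dotProduct_mulVec,
    Matrix.vecMul_transpose, EuclideanSpace.norm_sq_eq]
  simp [dotProduct, sq]

/-- Radial integrals over Euclidean space. -/
lemma integral_toLp_norm {d : ℕ} (hd : 0 < d) (f : ℝ → ℝ) :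
    ∫ z : Fin d → ℝ, f ‖WithLp.toLp 2 z‖ =
      (2 * π) ^ ((d : ℝ) / 2) * chiConst d * ∫ y in Set.Ioi (0 : ℝ), y ^ (d - 1) * f y := by
  have : Nonempty (Fin d) := ⟨⟨0, hd⟩⟩
  have h1 := (PiLp.volume_preserving_toLp (Fin d)).integral_comp
    (MeasurableEquiv.toLp 2 _).measurableEmbedding (fun z : EuclideanSpace ℝ (Fin d) => f ‖z‖)
  have h2 := integral_fun_norm_addHaar (volume : Measure (EuclideanSpace ℝ (Fin d))) f
  rw [h1, h2, finrank_euclideanSpace_fin, Measure.real, EuclideanSpace.volume_ball]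
  have hd' : (0 : ℝ) < d := by exact_mod_cast hd
  have hG : 0 < Real.Gamma ((d : ℝ) / 2) := Real.Gamma_pos_of_pos (by positivity)
  have hG1 : Real.Gamma ((d : ℝ) / 2 + 1) = d / 2 * Real.Gamma ((d : ℝ) / 2) :=
    Real.Gamma_add_one (by positivity)
  simp only [Fintype.card_fin, ENNReal.ofReal_one, one_pow, one_mul, nsmul_eq_mul, smul_eq_mul]
  rw [ENNReal.toReal_ofReal (by rw [hG1]; positivity), hG1, chiConst,
    Real.mul_rpow (by norm_num) pi_pos.le, ← mul_assoc]
  congr 1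
  have h3 : √π ^ d = π ^ ((d : ℝ) / 2) := by
    rw [Real.sqrt_eq_rpow, ← Real.rpow_natCast, ← Real.rpow_mul pi_pos.le]
    congr 1; ring
  rw [h3]
  field_simp

/-- The Gaussian density with mean `np` and covariance `n Σ_p`. -/
def scaledGauss (d n : ℕ) (p y : Fin d → ℝ) : ℝ :=
  Real.exp (-(quadForm d p (delVec d n p y) / 2)) /
    √((2 * π * n) ^ d * ∏ i, extP d p i)

lemma integral_quadForm_delVec {d n : ℕ} (hn : 0 < n) {p : Fin d → ℝ}
    (hp : p ∈ simplexInt d) {B : Matrix (Fin d) (Fin d) ℝ} (hB : precM d p = Bᵀ * B)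
    {f : ℝ → ℝ} (hf : Measurable f) :
    ∫ y : Fin d → ℝ, f ‖WithLp.toLp 2 (B *ᵥ delVec d n p y)‖ =
      √((n : ℝ) ^ d * ∏ i, extP d p i) * ∫ z : Fin d → ℝ, f ‖WithLp.toLp 2 z‖ := by
  have hn' : (0 : ℝ) < n := by exact_mod_cast hn
  have hP : 0 < ∏ i, extP d p i := Finset.prod_pos fun i _ => extP_pos hp i
  set M : Matrix (Fin d) (Fin d) ℝ := (√(n : ℝ))⁻¹ • B with hM
  have hdetB : B.det ^ 2 = (∏ i, extP d p i)⁻¹ := by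
    rw [← det_precM hp, hB, Matrix.det_mul, Matrix.det_transpose, sq]
  have hdetB0 : B.det ≠ 0 := by
    intro h
    rw [h] at hdetB
    have : 0 < (∏ i, extP d p i)⁻¹ := by positivity
    norm_num at hdetB
    linarith
  have hs : √(n : ℝ) ≠ 0 := (Real.sqrt_pos.2 hn').ne'
  have hdetM : M.det = (√(n : ℝ))⁻¹ ^ d * B.det := by rw [hM, Matrix.det_smul, Fintype.card_fin]
  have hdetM0 : M.det ≠ 0 := by rw [hdetM]; positivity
  have habs : |M.det⁻¹| = √((n : ℝ) ^ d * ∏ i, extP d p i) := by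
    rw [← Real.sqrt_sq_eq_abs]
    congr 1
    rw [hdetM, inv_pow, mul_pow, hdetB, mul_inv, inv_inv, ← pow_mul, mul_comm d, pow_mul, inv_pow,
      Real.sq_sqrt hn'.le, inv_pow, inv_inv]
  have e : ∀ y : Fin d → ℝ, B *ᵥ delVec d n p y = Matrix.toLin' M (y - fun i => n * p i) := by
    intro y
    rw [Matrix.toLin'_apply, hM, Matrix.smul_mulVec, ← Matrix.mulVec_smul]
    congr 1
    ext i
    simp only [delVec, del, Pi.smul_apply, Pi.sub_apply, smul_eq_mul]
    ring
  simp_rw [e]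
  rw [integral_sub_right_eq_self (μ := volume)
    (fun y : Fin d → ℝ => f ‖WithLp.toLp 2 (Matrix.toLin' M y)‖)]
  have hmeas : Measurable fun z : Fin d → ℝ => f ‖WithLp.toLp 2 z‖ :=
    hf.comp (continuous_norm.comp (PiLp.continuous_toLp 2 _)).measurable
  have hmap := Real.map_matrix_volume_pi_eq_smul_volume_pi hdetM0
  have h := integral_map (μ := volume) (φ := Matrix.toLin' M)
    (LinearMap.continuous_of_finiteDimensional _).measurable.aemeasurable
    (f := fun z : Fin d → ℝ => f ‖WithLp.toLp 2 z‖) hmeas.aestronglyMeasurable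
  rw [← h, hmap, integral_smul_measure, ENNReal.toReal_ofReal (abs_nonneg _), habs, smul_eq_mul]

/-- The Gaussian mass of an ellipsoid is an incomplete gamma function. -/
lemma integral_scaledGauss_ellipsoid {d n : ℕ} (hd : 0 < d) (hn : 0 < n) {p : Fin d → ℝ}
    (hp : p ∈ simplexInt d) {r : ℝ} (hr : 0 ≤ r) :
    ∫ y, Set.indicator {y | quadForm d p (delVec d n p y) ≤ r ^ 2} (scaledGauss d n p) y =
      regGamma ((d : ℝ) / 2) (r ^ 2 / 2) := by
  obtain ⟨B, hB⟩ := exists_precM_factor hp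
  have hn' : (0 : ℝ) < n := by exact_mod_cast hn
  have hP : 0 < ∏ i, extP d p i := Finset.prod_pos fun i _ => extP_pos hp i
  set f : ℝ → ℝ := Set.indicator (Set.Icc 0 r) (fun y => Real.exp (-(y ^ 2 / 2))) with hf
  have hfm : Measurable f := Measurable.indicator (by fun_prop) measurableSet_Icc
  have e : ∀ y, Set.indicator {y | quadForm d p (delVec d n p y) ≤ r ^ 2} (scaledGauss d n p) y =
      (√((2 * π * n) ^ d * ∏ i, extP d p i))⁻¹ *
        f ‖WithLp.toLp 2 (B *ᵥ delVec d n p y)‖ := by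
    intro y
    have hq := quadForm_eq_norm_sq hp hB (delVec d n p y)
    by_cases h : ‖WithLp.toLp 2 (B *ᵥ delVec d n p y)‖ ≤ r
    · have h' : quadForm d p (delVec d n p y) ≤ r ^ 2 := by
        rw [hq]; exact pow_le_pow_left₀ (norm_nonneg _) h 2
      rw [Set.indicator_of_mem (by exact h'), hf, Set.indicator_of_mem (Set.mem_Icc.2 ⟨norm_nonneg _, h⟩),
        scaledGauss, hq]
      ring
    · have h' : ¬ quadForm d p (delVec d n p y) ≤ r ^ 2 := by
        rw [hq]; exact fun h2 => h (by nlinarith [norm_nonneg (WithLp.toLp 2 (B *ᵥ delVec d n p y))])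
      rw [Set.indicator_of_notMem (by exact h'), hf, Set.indicator_of_notMem (fun h2 => h h2.2),
        mul_zero]
  simp_rw [e]
  rw [integral_const_mul, integral_quadForm_delVec hn hp hB hfm, integral_toLp_norm hd,
    regGamma_half_sq hd hr, intervalIntegral.integral_of_le hr]
  have e2 : ∫ y in Set.Ioi (0 : ℝ), y ^ (d - 1) * f y =
      ∫ y in Set.Ioc 0 r, y ^ (d - 1) * Real.exp (-(y ^ 2 / 2)) := by
    rw [← integral_indicator measurableSet_Ioi, ← integral_indicator measurableSet_Ioc]
    congr 1
    ext y
    by_cases h0 : 0 < y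
    · by_cases h1 : y ≤ r
      · rw [Set.indicator_of_mem (show y ∈ Set.Ioi 0 from h0),
          Set.indicator_of_mem (show y ∈ Set.Ioc 0 r from ⟨h0, h1⟩), hf,
          Set.indicator_of_mem (Set.mem_Icc.2 ⟨h0.le, h1⟩)]
      · rw [Set.indicator_of_notMem (fun h : y ∈ Set.Ioc 0 r => h1 h.2), hf]
        simp [h1]
    · rw [Set.indicator_of_notMem (show y ∉ Set.Ioi 0 from h0),
        Set.indicator_of_notMem (fun h : y ∈ Set.Ioc 0 r => h0 h.1)]
  rw [e2]
  have h3 : √((2 * π * n) ^ d * ∏ i, extP d p i) =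
      (2 * π) ^ ((d : ℝ) / 2) * √((n : ℝ) ^ d * ∏ i, extP d p i) := by
    rw [mul_pow, mul_assoc, Real.sqrt_mul (by positivity), Real.sqrt_eq_rpow, ← Real.rpow_natCast,
      ← Real.rpow_mul (by positivity)]
    congr 2; ring
  rw [h3]
  have : 0 < √((n : ℝ) ^ d * ∏ i, extP d p i) := Real.sqrt_pos.2 (by positivity)
  field_simp

/-- A vector of counts together with the remaining count. -/
def extK (d n : ℕ) (k : Fin d → ℕ) : Fin (d + 1) → ℕ := Fin.snoc k (n - ∑ i, k i)

lemma sum_extK {d n : ℕ} {k : Fin d → ℕ} (hk : ∑ i, k i ≤ n) : ∑ i, extK d n k i = n := by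
  simp [extK, Fin.sum_univ_castSucc, hk]

lemma extV_castK {d n : ℕ} {k : Fin d → ℕ} (hk : ∑ i, k i ≤ n) (i : Fin (d + 1)) :
    extV d n (castK d k) i = extK d n k i := by
  refine Fin.lastCases ?_ (fun j => ?_) i
  · simp [extV, extK, castK, Nat.cast_sub hk]
  · simp [extV, extK, castK]

lemma multinomialPMF_eq {d n : ℕ} (p : Fin d → ℝ) {k : Fin d → ℕ} (hk : ∑ i, k i ≤ n) :
    multinomialPMF d n p k =
      (n.factorial : ℝ) / (∏ i, ((extK d n k i).factorial : ℝ)) * ∏ i, extP d p i ^ extK d n k i := by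
  rw [multinomialPMF, if_pos hk]
  simp [extK, extP, Fin.prod_univ_castSucc]

lemma multinomialPMF_pos {d n : ℕ} {p : Fin d → ℝ} (hp : p ∈ simplexInt d) {k : Fin d → ℕ}
    (hk : ∑ i, k i ≤ n) : 0 < multinomialPMF d n p k := by
  rw [multinomialPMF_eq p hk]
  have h1 : 0 < ∏ i, extP d p i ^ extK d n k i :=
    Finset.prod_pos fun i _ => pow_pos (extP_pos hp i) _
  have h2 : 0 < ∏ i, ((extK d n k i).factorial : ℝ) :=
    Finset.prod_pos fun i _ => by positivity
  positivity

lemma multinomialPMF_nonneg {d n : ℕ} {p : Fin d → ℝ} (hp : p ∈ simplexInt d) (k : Fin d → ℕ) :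
    0 ≤ multinomialPMF d n p k := by
  by_cases hk : ∑ i, k i ≤ n
  · exact (multinomialPMF_pos hp hk).le
  · rw [multinomialPMF, if_neg hk]

/-- A finite box containing the support of the multinomial law. -/
def countBox (d n : ℕ) : Finset (Fin d → ℕ) := Fintype.piFinset fun _ => Finset.range (n + 1)

lemma mem_countBox {d n : ℕ} {k : Fin d → ℕ} (hk : ∑ i, k i ≤ n) : k ∈ countBox d n := by
  simp only [countBox, Fintype.mem_piFinset, Finset.mem_range]
  intro i
  have := Finset.single_le_sum (f := k) (fun _ _ => Nat.zero_le _) (Finset.mem_univ i)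
  omega

lemma card_countBox (d n : ℕ) : (countBox d n).card = (n + 1) ^ d := by
  simp [countBox, Fintype.card_piFinset]

lemma multinomialPMF_eq_zero {d n : ℕ} (p : Fin d → ℝ) {k : Fin d → ℕ} (hk : k ∉ countBox d n) :
    multinomialPMF d n p k = 0 := by
  rw [multinomialPMF, if_neg fun h => hk (mem_countBox h)]

lemma sum_multinomialPMF (d n : ℕ) (p : Fin d → ℝ) :
    ∑ k ∈ countBox d n, multinomialPMF d n p k = 1 := by
  have h := Finset.sum_pow_eq_sum_piAntidiag Finset.univ (extP d p) n
  rw [sum_extP, one_pow] at h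
  rw [h]
  have h1 : ∑ k ∈ countBox d n, multinomialPMF d n p k =
      ∑ k ∈ (countBox d n).filter (fun k => ∑ i, k i ≤ n), multinomialPMF d n p k := by
    rw [Finset.sum_filter]
    refine Finset.sum_congr rfl fun k _ => ?_
    split_ifs with hk
    · rfl
    · rw [multinomialPMF, if_neg hk]
  rw [h1]
  refine Finset.sum_nbij' (extK d n) (fun K => Fin.init K) ?_ ?_ ?_ ?_ ?_
  · intro k hk
    simp only [Finset.mem_filter] at hk
    simp [Finset.mem_piAntidiag, sum_extK hk.2]
  · intro K hK
    simp only [Finset.mem_piAntidiag, Finset.mem_univ, implies_true, and_true] at hK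
    have : ∑ i, Fin.init K i ≤ n := by
      rw [← hK, Fin.sum_univ_castSucc]; simp [Fin.init]
    exact Finset.mem_filter.2 ⟨mem_countBox this, this⟩
  · intro k _
    simp [extK]
  · intro K hK
    simp only [Finset.mem_piAntidiag, Finset.mem_univ, implies_true, and_true] at hK
    have : n - ∑ i, Fin.init K i = K (Fin.last d) := by
      rw [← hK, Fin.sum_univ_castSucc]; simp [Fin.init]
    rw [extK, this, Fin.snoc_init_self]
  · intro k hk
    simp only [Finset.mem_filter] at hk
    rw [multinomialPMF_eq p hk.2]
    congr 1
    have := Nat.multinomial_spec Finset.univ (extK d n k)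
    rw [sum_extK hk.2] at this
    rw [← this]
    push_cast
    rw [mul_div_cancel_left₀]
    exact Finset.prod_ne_zero_iff.2 fun i _ => by positivity

lemma multinomialPMF_le_one {d n : ℕ} {p : Fin d → ℝ} (hp : p ∈ simplexInt d) (k : Fin d → ℕ) :
    multinomialPMF d n p k ≤ 1 := by
  by_cases hk : k ∈ countBox d n
  · rw [← sum_multinomialPMF d n p]
    exact Finset.single_le_sum (f := multinomialPMF d n p)
      (fun k _ => multinomialPMF_nonneg hp k) hk
  · rw [multinomialPMF_eq_zero p hk]; exact zero_le_one

lemma confSum_eq (d n : ℕ) (p : Fin d → ℝ) (nh : Fin d → ℕ) :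
    confSum d n p nh = ∑ k ∈ (countBox d n).filter
      (fun k => multinomialPMF d n p nh ≤ multinomialPMF d n p k), multinomialPMF d n p k := by
  rw [confSum, tsum_eq_sum (s := countBox d n), Finset.sum_filter]
  · exact Finset.sum_congr rfl fun k _ => by simp [Set.indicator_apply]
  · intro k hk
    simp [Set.indicator_apply, multinomialPMF_eq_zero p hk]

/-- The confidence sum is close to one whenever the observed count is very unlikely. -/
lemma one_sub_le_confSum {d n : ℕ} {p : Fin d → ℝ} (hp : p ∈ simplexInt d) (nh : Fin d → ℕ) :
    1 - ((n : ℝ) + 1) ^ d * multinomialPMF d n p nh ≤ confSum d n p nh := by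
  have hsum := sum_multinomialPMF d n p
  rw [← Finset.sum_filter_add_sum_filter_not _
    (fun k => multinomialPMF d n p nh ≤ multinomialPMF d n p k)] at hsum
  rw [confSum_eq]
  have : ∑ k ∈ (countBox d n).filter
      (fun k => ¬ multinomialPMF d n p nh ≤ multinomialPMF d n p k), multinomialPMF d n p k ≤
      ((n : ℝ) + 1) ^ d * multinomialPMF d n p nh := by
    refine (Finset.sum_le_card_nsmul _ _ (multinomialPMF d n p nh) fun k hk => ?_).trans ?_
    · exact (not_le.1 (Finset.mem_filter.1 hk).2).le
    · rw [nsmul_eq_mul]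
      refine mul_le_mul_of_nonneg_right ?_ (multinomialPMF_nonneg hp _)
      have := Finset.card_filter_le (countBox d n)
        (fun k => ¬ multinomialPMF d n p nh ≤ multinomialPMF d n p k)
      rw [card_countBox] at this
      exact_mod_cast this
  linarith

lemma sum_le_confSum {d n : ℕ} {p : Fin d → ℝ} (hp : p ∈ simplexInt d) (nh : Fin d → ℕ)
    {S : Finset (Fin d → ℕ)}
    (hS : ∀ k ∈ S, multinomialPMF d n p nh ≤ multinomialPMF d n p k) (hbox : S ⊆ countBox d n) :
    ∑ k ∈ S, multinomialPMF d n p k ≤ confSum d n p nh := by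
  rw [confSum_eq]
  exact Finset.sum_le_sum_of_subset_of_nonneg
    (fun k hk => Finset.mem_filter.2 ⟨hbox hk, hS k hk⟩)
    fun k _ _ => multinomialPMF_nonneg hp k

lemma abs_log_one_add_le {x : ℝ} (hx : |x| ≤ 1 / 100) : |Real.log (1 + x)| ≤ 2 * |x| := by
  have h := Real.abs_log_sub_add_sum_range_le (x := -x) (by rw [abs_neg]; linarith) 1
  simp only [Finset.sum_range_one, abs_neg, sub_neg_eq_add] at h
  norm_num at h
  have h2 : |x| ^ 2 / (1 - |x|) ≤ |x| := by
    rw [div_le_iff₀ (by linarith)]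
    nlinarith [abs_nonneg x]
  rw [sq_abs] at h2
  have h3 : Real.log (1 + x) = (-x + Real.log (1 + x)) + x := by ring
  rw [h3]
  exact (abs_add_le _ _).trans (by linarith)

lemma abs_one_add_mul_log_sub_le {x : ℝ} (hx : |x| ≤ 1 / 100) :
    |(1 + x) * Real.log (1 + x) - x - x ^ 2 / 2| ≤ 2 * |x| ^ 3 := by
  have h := Real.abs_log_sub_add_sum_range_le (x := -x) (by rw [abs_neg]; linarith) 2
  simp only [Finset.sum_range_succ, Finset.sum_range_zero, abs_neg, sub_neg_eq_add] at h
  norm_num at h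
  set e := -x + x ^ 2 / 2 + Real.log (1 + x) with he
  have h2 : |x| ^ 3 / (1 - |x|) ≤ 100 / 99 * |x| ^ 3 := by
    rw [div_le_iff₀ (by linarith)]
    have : 0 ≤ |x| ^ 3 := by positivity
    nlinarith
  have h4 : (1 + x) * Real.log (1 + x) - x - x ^ 2 / 2 = (1 + x) * e - x ^ 3 / 2 := by
    rw [he]; ring
  rw [h4]
  have h5 : |1 + x| ≤ 101 / 100 := by
    rw [abs_le] at hx ⊢; constructor <;> linarith [hx.1, hx.2]
  have h6 : |(1 + x) * e| ≤ 101 / 100 * (100 / 99 * |x| ^ 3) := by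
    rw [abs_mul]
    exact mul_le_mul h5 (h.trans h2) (abs_nonneg _) (by norm_num)
  have h7 : |x ^ 3 / 2| = |x| ^ 3 / 2 := by rw [abs_div, abs_pow]; norm_num
  have h8 : 0 ≤ |x| ^ 3 := by positivity
  exact (abs_sub _ _).trans (by rw [h7]; linarith)

/-- Local limit theorem for the multinomial law, with explicit error. -/
lemma abs_log_multinomialPMF_sub_le {d n : ℕ} (hn : 0 < n) {p : Fin d → ℝ}
    (hp : p ∈ simplexInt d) {a r : ℝ} (ha : 0 < a) (hw : ∀ i, 1 ≤ n * a ^ 2 * extP d p i)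
    (hr : 0 ≤ r) (har : a * r ≤ 1 / 100) {k : Fin d → ℕ} (hk : ∑ i, k i ≤ n)
    (hQ : quadForm d p (delVec d n p (castK d k)) ≤ r ^ 2) :
    |Real.log (multinomialPMF d n p k) - Real.log (scaledGauss d n p (castK d k))| ≤
      2 * a * r ^ 3 + (d + 1) * a * r + (d + 1) * a ^ 2 := by
  have hn' : (0 : ℝ) < n := by exact_mod_cast hn
  set w := extP d p with hwdef
  set K := extK d n k with hK
  set Q := quadForm d p (delVec d n p (castK d k)) with hQdef
  have hwpos : ∀ i, 0 < w i := extP_pos hp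
  have hnw : ∀ i, 0 < n * w i := fun i => mul_pos hn' (hwpos i)
  set x : Fin (d + 1) → ℝ := fun i => (K i - n * w i) / (n * w i) with hx
  have hKx : ∀ i, (K i : ℝ) = n * w i * (1 + x i) := by
    intro i
    have h1 := hn'.ne'
    have h2 := (hwpos i).ne'
    simp only [hx]; field_simp; ring
  have hQsum : Q = ∑ i, n * w i * x i ^ 2 := by
    rw [hQdef, quadForm_delVec hn hp]
    refine Finset.sum_congr rfl fun i _ => ?_
    rw [extV_castK hk]
    have h1 := hn'.ne'
    have h2 := (hwpos i).ne'
    change ((K i : ℝ) - n * w i) ^ 2 / (n * w i) = _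
    simp only [hx]; field_simp
  have hterm : ∀ i, n * w i * x i ^ 2 ≤ Q := by
    intro i
    rw [hQsum]
    exact Finset.single_le_sum (f := fun i => n * w i * x i ^ 2)
      (fun j _ => mul_nonneg (hnw j).le (sq_nonneg _)) (Finset.mem_univ i)
  have hxar : ∀ i, |x i| ≤ a * r := by
    intro i
    refine abs_le_of_sq_le_sq ?_ (by positivity)
    have h1 := hterm i
    have h2 := mul_le_mul_of_nonneg_right (hw i) (sq_nonneg (x i))
    have h3 := mul_le_mul_of_nonneg_left (h1.trans hQ) (sq_nonneg a)
    calc x i ^ 2 ≤ n * a ^ 2 * w i * x i ^ 2 := by linarith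
      _ = a ^ 2 * (n * w i * x i ^ 2) := by ring
      _ ≤ (a * r) ^ 2 := by rw [mul_pow]; exact h3
  have hx100 : ∀ i, |x i| ≤ 1 / 100 := fun i => (hxar i).trans har
  have hxpos : ∀ i, 1 / 2 ≤ 1 + x i := fun i => by
    have := (abs_le.1 (hx100 i)).1; linarith
  have hKpos : ∀ i, (0 : ℝ) < K i := fun i => by
    rw [hKx]; exact mul_pos (hnw i) (by linarith [hxpos i])
  have hKne : ∀ i, K i ≠ 0 := fun i => by
    have := hKpos i
    exact_mod_cast this.ne'
  obtain ⟨θ, hθ0, hθ1, hθ⟩ := log_factorial_stirling_bounds hn.ne'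
  choose t ht0 ht1 ht using fun i => log_factorial_stirling_bounds (hKne i)
  have hsumK : ∑ i, (K i : ℝ) = n := by
    exact_mod_cast sum_extK hk
  have hsumw : ∑ i, w i = 1 := sum_extP d p
  have hsumx : ∑ i, n * w i * x i = 0 := by
    have : ∀ i, n * w i * x i = K i - n * w i := fun i => by rw [hKx i]; ring
    simp_rw [this, Finset.sum_sub_distrib, ← Finset.mul_sum]
    rw [hsumK, hsumw]; ring
  have hlogK : ∀ i, Real.log (K i) = Real.log n + Real.log (w i) + Real.log (1 + x i) := by
    intro i
    rw [hKx i, Real.log_mul (hnw i).ne' (by linarith [hxpos i]), Real.log_mul hn'.ne' (hwpos i).ne']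
  have hlogP : Real.log (multinomialPMF d n p k) =
      Real.log n.factorial - ∑ i, Real.log (K i).factorial + ∑ i, K i * Real.log (w i) := by
    rw [multinomialPMF_eq p hk, Real.log_mul, Real.log_div, Real.log_prod, Real.log_prod]
    · congr 1
      exact Finset.sum_congr rfl fun i _ => Real.log_pow _ _
    · exact fun i _ => pow_ne_zero _ (hwpos i).ne'
    · exact fun i _ => by positivity
    · positivity
    · exact Finset.prod_ne_zero_iff.2 fun i _ => by positivity
    · exact div_ne_zero (by positivity) (Finset.prod_ne_zero_iff.2 fun i _ => by positivity)
    · exact Finset.prod_ne_zero_iff.2 fun i _ => pow_ne_zero _ (hwpos i).ne'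
  have hprod : 0 < ∏ i, w i := Finset.prod_pos fun i _ => hwpos i
  have hlogG : Real.log (scaledGauss d n p (castK d k)) =
      -(Q / 2) - (d * (Real.log (2 * π) + Real.log n) + ∑ i, Real.log (w i)) / 2 := by
    rw [scaledGauss, Real.log_div (Real.exp_pos _).ne' (Real.sqrt_pos.2 (by positivity)).ne',
      Real.log_exp, Real.log_sqrt (by positivity), Real.log_mul (by positivity) hprod.ne',
      Real.log_pow, Real.log_mul (by positivity) hn'.ne', Real.log_prod fun i _ => (hwpos i).ne']
  set e : Fin (d + 1) → ℝ := fun i => n * w i * ((1 + x i) * Real.log (1 + x i) - x i - x i ^ 2 / 2)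
    with he
  have hmain : Real.log (multinomialPMF d n p k) - Real.log (scaledGauss d n p (castK d k)) =
      θ - ∑ i, (e i + Real.log (1 + x i) / 2 + t i) := by
    have h1 : ∀ i, Real.log (K i).factorial - K i * Real.log (w i) =
        K i * Real.log n - K i + (Real.log n + Real.log (w i)) / 2 + Real.log (2 * π) / 2
          + n * w i * x i + n * w i * x i ^ 2 / 2
          + (e i + Real.log (1 + x i) / 2 + t i) := by
      intro i
      rw [ht i, hlogK i]
      simp only [he]
      rw [hKx i]
      ring
    have h2 : ∑ i, (Real.log (K i).factorial - K i * Real.log (w i)) =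
        n * Real.log n - n + ((d + 1) * Real.log n + ∑ i, Real.log (w i)) / 2
          + (d + 1) * (Real.log (2 * π) / 2) + Q / 2
          + ∑ i, (e i + Real.log (1 + x i) / 2 + t i) := by
      simp_rw [h1]
      simp only [Finset.sum_add_distrib, Finset.sum_sub_distrib, ← Finset.sum_mul, hsumK, hsumx,
        ← Finset.sum_div, ← hQsum, Finset.sum_const, Finset.card_univ, Fintype.card_fin,
        nsmul_eq_mul]
      push_cast
      ring
    rw [Finset.sum_sub_distrib] at h2
    rw [hlogP, hlogG, hθ]
    linear_combination -h2
  have hna : 1 ≤ n * a ^ 2 := by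
    calc (1 : ℝ) = ∑ i, w i := hsumw.symm
      _ ≤ ∑ i, n * a ^ 2 * w i * w i := by
        refine Finset.sum_le_sum fun i _ => ?_
        nlinarith [hw i, hwpos i]
      _ ≤ ∑ i, n * a ^ 2 * w i := by
        refine Finset.sum_le_sum fun i _ => ?_
        have : w i ≤ 1 := by
          rw [← hsumw]
          exact Finset.single_le_sum (fun j _ => (hwpos j).le) (Finset.mem_univ i)
        exact mul_le_of_le_one_right (by have := hwpos i; positivity) this
      _ = n * a ^ 2 := by rw [← Finset.mul_sum, hsumw, mul_one]
  have hθa : θ ≤ a ^ 2 / 12 := by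
    refine hθ1.trans ?_
    rw [div_le_div_iff₀ (by positivity) (by norm_num)]
    nlinarith
  have hta : ∀ i, t i ≤ a ^ 2 / 6 := by
    intro i
    refine (ht1 i).trans ?_
    rw [div_le_div_iff₀ (by have := hKpos i; positivity) (by norm_num)]
    have h1 : (n * a ^ 2 * w i) * (1 / 2) ≤ a ^ 2 * K i := by
      rw [hKx i]
      calc (n * a ^ 2 * w i) * (1 / 2) ≤ (n * a ^ 2 * w i) * (1 + x i) :=
            mul_le_mul_of_nonneg_left (hxpos i) (by linarith [hw i])
        _ = _ := by ring
    nlinarith [hw i]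
  have hea : ∀ i, |e i| ≤ 2 * a * r * (n * w i * x i ^ 2) := by
    intro i
    simp only [he]
    rw [abs_mul, abs_of_pos (hnw i)]
    calc _ ≤ n * w i * (2 * |x i| ^ 3) :=
          mul_le_mul_of_nonneg_left (abs_one_add_mul_log_sub_le (hx100 i)) (hnw i).le
      _ = 2 * |x i| * (n * w i * x i ^ 2) := by rw [← sq_abs (x i)]; ring
      _ ≤ _ := by
        refine mul_le_mul_of_nonneg_right ?_ (mul_nonneg (hnw i).le (sq_nonneg _))
        linarith [hxar i]
  have hsum : |∑ i, (e i + Real.log (1 + x i) / 2 + t i)| ≤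
      2 * a * r * Q + (d + 1) * (a * r) + (d + 1) * (a ^ 2 / 6) := by
    calc _ ≤ ∑ i, |e i + Real.log (1 + x i) / 2 + t i| := Finset.abs_sum_le_sum_abs _ _
      _ ≤ ∑ i, (2 * a * r * (n * w i * x i ^ 2) + a * r + a ^ 2 / 6) := by
        refine Finset.sum_le_sum fun i _ => ?_
        have h1 := abs_log_one_add_le (hx100 i)
        have h2 : |Real.log (1 + x i) / 2| ≤ a * r := by
          rw [abs_div, abs_two]
          linarith [hxar i]
        have h3 : |t i| ≤ a ^ 2 / 6 := by rw [abs_of_nonneg (ht0 i)]; exact hta i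
        exact (abs_add_three _ _ _).trans (add_le_add (add_le_add (hea i) h2) h3)
      _ = _ := by
        rw [Finset.sum_add_distrib, Finset.sum_add_distrib, ← Finset.mul_sum, ← hQsum]
        simp
  rw [hmain]
  have h9 : 2 * a * r * Q ≤ 2 * a * r ^ 3 := by
    calc 2 * a * r * Q ≤ 2 * a * r * r ^ 2 := mul_le_mul_of_nonneg_left hQ (by positivity)
      _ = _ := by ring
  have hd0 : (0 : ℝ) ≤ d := by positivity
  have h10 : |θ - ∑ i, (e i + Real.log (1 + x i) / 2 + t i)| ≤
      |θ| + |∑ i, (e i + Real.log (1 + x i) / 2 + t i)| := abs_sub _ _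
  rw [abs_of_nonneg hθ0] at h10
  nlinarith [mul_nonneg hd0 (sq_nonneg a)]

/-- Points of a small ellipsoid around the mean have nonnegative extended coordinates. -/
lemma extV_nonneg_of_quadForm_le {d n : ℕ} (hn : 0 < n) {p : Fin d → ℝ} (hp : p ∈ simplexInt d)
    {a r : ℝ} (ha : 0 < a) (hw : ∀ i, 1 ≤ n * a ^ 2 * extP d p i) (hr : 0 ≤ r)
    (har : a * r ≤ 1 / 100) {y : Fin d → ℝ} (hQ : quadForm d p (delVec d n p y) ≤ r ^ 2)
    (i : Fin (d + 1)) : 0 ≤ extV d n y i := by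
  have hn' : (0 : ℝ) < n := by exact_mod_cast hn
  have hnw : ∀ i, 0 < n * extP d p i := fun i => mul_pos hn' (extP_pos hp i)
  rw [quadForm_delVec hn hp] at hQ
  have h1 := (Finset.single_le_sum
    (f := fun i => (extV d n y i - n * extP d p i) ^ 2 / (n * extP d p i))
    (fun j _ => div_nonneg (sq_nonneg _) (hnw j).le) (Finset.mem_univ i)).trans hQ
  rw [div_le_iff₀ (hnw i)] at h1
  have h2 : r ^ 2 * (n * extP d p i) ≤ (n * extP d p i) ^ 2 := by
    have h3 : r ^ 2 ≤ n * extP d p i := by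
      have h4 : (a * r) ^ 2 ≤ 1 := by
        have : 0 ≤ a * r := by positivity
        nlinarith
      have h5 : a ^ 2 * r ^ 2 ≤ a ^ 2 * (n * extP d p i) := by
        linarith [hw i, mul_pow a r 2]
      exact le_of_mul_le_mul_left h5 (by positivity)
    rw [sq (n * extP d p i)]
    exact mul_le_mul_of_nonneg_right h3 (hnw i).le
  have := (abs_le.1 (abs_le_of_sq_le_sq (h1.trans h2) (hnw i).le)).1
  linarith

/-- The Mahalanobis distance changes little under a perturbation of size at most one. -/
lemma quadForm_delVec_le_of_close {d n : ℕ} (hn : 0 < n) {p : Fin d → ℝ}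
    (hp : p ∈ simplexInt d) {a r : ℝ} (ha : 0 < a) (hw : ∀ i, 1 ≤ n * a ^ 2 * extP d p i)
    (hr : 0 ≤ r) {y z : Fin d → ℝ} (hyz : ∀ i, |z i - y i| ≤ 1)
    (hQ : quadForm d p (delVec d n p y) ≤ r ^ 2) :
    quadForm d p (delVec d n p z) ≤ (r + a * (d + 1)) ^ 2 := by
  have hn' : (0 : ℝ) < n := by exact_mod_cast hn
  obtain ⟨B, hB⟩ := exists_precM_factor hp
  set v : Fin d → ℝ := fun i => z i - y i + n * p i with hv
  have hdecomp : delVec d n p z = delVec d n p y + delVec d n p v := by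
    funext i
    simp only [delVec, del, hv, Pi.add_apply]
    ring
  have hv2 : quadForm d p (delVec d n p v) ≤ (a * (d + 1)) ^ 2 := by
    rw [quadForm_delVec hn hp]
    have hb : ∀ i, (extV d n v i - n * extP d p i) ^ 2 / (n * extP d p i) ≤
        a ^ 2 * (extV d n v i - n * extP d p i) ^ 2 := by
      intro i
      have hnw : 0 < n * extP d p i := mul_pos hn' (extP_pos hp i)
      rw [div_le_iff₀ hnw]
      nlinarith [mul_le_mul_of_nonneg_right (hw i)
        (sq_nonneg (extV d n v i - n * extP d p i))]
    refine (Finset.sum_le_sum fun i _ => hb i).trans ?_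
    rw [← Finset.mul_sum, Fin.sum_univ_castSucc, mul_pow]
    refine mul_le_mul_of_nonneg_left ?_ (sq_nonneg a)
    have h1 : ∑ i : Fin d, (extV d n v i.castSucc - n * extP d p i.castSucc) ^ 2 ≤ d := by
      calc _ ≤ ∑ i : Fin d, (1 : ℝ) := by
            refine Finset.sum_le_sum fun i _ => ?_
            simp only [extV, extP, Fin.snoc_castSucc, hv, add_sub_cancel_right]
            rw [sq_le_one_iff_abs_le_one]
            exact hyz i
        _ = d := by simp
    have h2 : (extV d n v (Fin.last d) - n * extP d p (Fin.last d)) ^ 2 ≤ (d : ℝ) ^ 2 := by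
      have h3 : extV d n v (Fin.last d) - n * extP d p (Fin.last d) = -∑ i, (z i - y i) := by
        simp only [extV, extP, Fin.snoc_last, hv, Finset.sum_add_distrib, ← Finset.mul_sum]
        ring
      rw [h3, neg_sq]
      refine sq_le_sq' ?_ ?_
      · have := Finset.sum_le_sum fun i (_ : i ∈ Finset.univ) => (abs_le.1 (hyz i)).1
        simpa using this
      · have := Finset.sum_le_sum fun i (_ : i ∈ Finset.univ) => (abs_le.1 (hyz i)).2
        simpa using this
    have : (0 : ℝ) ≤ d := by positivity
    nlinarith
  rw [quadForm_eq_norm_sq hp hB] at hQ hv2 ⊢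
  have ha1 : 0 ≤ a * (d + 1) := by positivity
  have e1 := abs_le_of_sq_le_sq hQ hr
  have e2 := abs_le_of_sq_le_sq hv2 ha1
  rw [abs_norm] at e1 e2
  rw [hdecomp, Matrix.mulVec_add, WithLp.toLp_add]
  exact pow_le_pow_left₀ (norm_nonneg _) ((norm_add_le _ _).trans (add_le_add e1 e2)) 2

/-- The half-open unit cube with lowest corner `k`. -/
def unitCube (d : ℕ) (k : Fin d → ℕ) : Set (Fin d → ℝ) :=
  Set.univ.pi fun i => Set.Ico (k i : ℝ) (k i + 1)

lemma measurableSet_unitCube (d : ℕ) (k : Fin d → ℕ) : MeasurableSet (unitCube d k) :=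
  MeasurableSet.univ_pi fun _ => measurableSet_Ico

lemma volume_unitCube (d : ℕ) (k : Fin d → ℕ) : volume (unitCube d k) = 1 := by
  rw [unitCube, Real.volume_pi_Ico]
  simp

lemma integral_sum_unitCube {d : ℕ} (S : Finset (Fin d → ℕ)) (c : (Fin d → ℕ) → ℝ) :
    Integrable (fun y => ∑ k ∈ S, (unitCube d k).indicator (fun _ => c k) y) ∧
      ∫ y, ∑ k ∈ S, (unitCube d k).indicator (fun _ => c k) y = ∑ k ∈ S, c k := by
  have hint : ∀ k ∈ S, Integrable fun y => (unitCube d k).indicator (fun _ => c k) y := by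
    intro k _
    refine (integrable_indicator_iff (measurableSet_unitCube d k)).2 ?_
    exact integrableOn_const (by rw [volume_unitCube]; exact ENNReal.one_ne_top)
  refine ⟨integrable_finsetSum _ hint, ?_⟩
  rw [integral_finsetSum _ hint]
  refine Finset.sum_congr rfl fun k _ => ?_
  rw [integral_indicator (measurableSet_unitCube d k), setIntegral_const, Measure.real,
    volume_unitCube]
  simp

lemma scaledGauss_pos {d n : ℕ} (hn : 0 < n) {p : Fin d → ℝ} (hp : p ∈ simplexInt d)
    (y : Fin d → ℝ) : 0 < scaledGauss d n p y := by
  have hn' : (0 : ℝ) < n := by exact_mod_cast hn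
  have : 0 < ∏ i, extP d p i := Finset.prod_pos fun i _ => extP_pos hp i
  rw [scaledGauss]
  positivity

/-- A lower bound for the multinomial mass of an ellipsoid in terms of a chi-square
probability. -/
lemma exp_neg_mul_regGamma_le_sum {d n : ℕ} (hd : 0 < d) (hn : 0 < n) {p : Fin d → ℝ}
    (hp : p ∈ simplexInt d) {a R ρ : ℝ} (ha : 0 < a) (hw : ∀ i, 1 ≤ n * a ^ 2 * extP d p i)
    (hρ : 0 ≤ ρ) (hρR : ρ + a * (d + 1) ≤ R) (haR : a * R ≤ 1 / 100) :
    Real.exp (-(2 * a * R ^ 3 + (d + 1) * a * R + (d + 1) * a ^ 2 + a * (d + 1) * R)) *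
        regGamma (d / 2) (ρ ^ 2 / 2) ≤
      ∑ k ∈ (countBox d n).filter (fun k => ∑ i, k i ≤ n ∧
        quadForm d p (delVec d n p (castK d k)) ≤ (ρ + a * (d + 1)) ^ 2),
        multinomialPMF d n p k := by
  set j := a * ((d : ℝ) + 1) with hj
  have hj0 : 0 ≤ j := by positivity
  have hR : 0 ≤ R := by linarith
  set S := (countBox d n).filter (fun k => ∑ i, k i ≤ n ∧
        quadForm d p (delVec d n p (castK d k)) ≤ (ρ + j) ^ 2) with hS
  set E := 2 * a * R ^ 3 + (d + 1) * a * R + (d + 1) * a ^ 2 with hE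
  rw [← integral_scaledGauss_ellipsoid hd hn hp hρ, ← integral_const_mul]
  obtain ⟨hi, hs⟩ := integral_sum_unitCube S (multinomialPMF d n p)
  rw [← hs]
  refine integral_mono_of_nonneg ?_ hi ?_
  · refine Filter.Eventually.of_forall fun y => mul_nonneg (Real.exp_pos _).le ?_
    exact Set.indicator_nonneg (fun z _ => (scaledGauss_pos hn hp z).le) y
  refine Filter.Eventually.of_forall fun y => ?_
  have hterm : ∀ k ∈ S, 0 ≤ (unitCube d k).indicator (fun _ => multinomialPMF d n p k) y :=
    fun k _ => Set.indicator_nonneg (fun _ _ => multinomialPMF_nonneg hp k) y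
  by_cases hy : quadForm d p (delVec d n p y) ≤ ρ ^ 2
  swap
  · simp only [Set.indicator_apply, Set.mem_ofPred_eq, hy, if_false, mul_zero]
    exact Finset.sum_nonneg hterm
  have haρ : a * ρ ≤ 1 / 100 := (mul_le_mul_of_nonneg_left (by linarith) ha.le).trans haR
  have hext := extV_nonneg_of_quadForm_le hn hp ha hw hρ haρ hy
  have hy0 : ∀ i, 0 ≤ y i := fun i => by simpa [extV] using hext i.castSucc
  have hysum : ∑ i, y i ≤ n := by simpa [extV] using hext (Fin.last d)
  set k : Fin d → ℕ := fun i => ⌊y i⌋₊ with hk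
  have hky : ∀ i, |castK d k i - y i| ≤ 1 := by
    intro i
    have h1 := Nat.floor_le (hy0 i)
    have h2 := (Nat.lt_floor_add_one (y i)).le
    simp only [castK, hk]
    rw [abs_le]; constructor <;> linarith
  have hksum : ∑ i, k i ≤ n := by
    have : (∑ i, (k i : ℝ)) ≤ n :=
      (Finset.sum_le_sum fun i _ => Nat.floor_le (hy0 i)).trans hysum
    exact_mod_cast this
  have hkQ' : ∀ r : ℝ, 0 ≤ r → quadForm d p (delVec d n p y) ≤ r ^ 2 →
      quadForm d p (delVec d n p (castK d k)) ≤ (r + j) ^ 2 := fun r hr hQ =>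
    quadForm_delVec_le_of_close hn hp ha hw hr hky hQ
  have hkQ := hkQ' ρ hρ hy
  have hkS : k ∈ S := Finset.mem_filter.2 ⟨mem_countBox hksum, hksum, hkQ⟩
  have hycube : y ∈ unitCube d k := by
    intro i _
    exact ⟨Nat.floor_le (hy0 i), Nat.lt_floor_add_one (y i)⟩
  refine le_trans ?_ (Finset.single_le_sum hterm hkS)
  beta_reduce
  rw [Set.indicator_of_mem hycube, Set.indicator_of_mem
    (show y ∈ {y | quadForm d p (delVec d n p y) ≤ ρ ^ 2} from hy)]
  have hkQR : quadForm d p (delVec d n p (castK d k)) ≤ R ^ 2 :=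
    hkQ.trans (pow_le_pow_left₀ (by positivity) hρR 2)
  have hllt := abs_log_multinomialPMF_sub_le hn hp ha hw hR haR hksum hkQR
  have hPpos := multinomialPMF_pos hp hksum
  have hgpos := scaledGauss_pos hn hp (castK d k)
  have hQy0 : 0 ≤ quadForm d p (delVec d n p y) := by
    obtain ⟨B, hB⟩ := exists_precM_factor hp
    rw [quadForm_eq_norm_sq hp hB]
    positivity
  have hgk : scaledGauss d n p y * Real.exp (-(j * R)) ≤ scaledGauss d n p (castK d k) := by
    rw [scaledGauss, scaledGauss, div_mul_eq_mul_div, ← Real.exp_add]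
    refine div_le_div_of_nonneg_right (Real.exp_le_exp.2 ?_) (Real.sqrt_nonneg _)
    set q := √(quadForm d p (delVec d n p y)) with hq
    have hq2 : q ^ 2 = quadForm d p (delVec d n p y) := Real.sq_sqrt hQy0
    have hqρ : q ≤ ρ := by
      rw [hq]; exact Real.sqrt_le_iff.2 ⟨hρ, hy⟩
    have h1 := hkQ' q (Real.sqrt_nonneg _) hq2.ge
    have h2 : j * (q + j) ≤ j * R := mul_le_mul_of_nonneg_left (by linarith) hj0
    rw [← hq2]
    nlinarith
  have hlog : Real.log (scaledGauss d n p (castK d k)) - E ≤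
      Real.log (multinomialPMF d n p k) := by
    have := (abs_le.1 hllt).1
    linarith
  have hexp := Real.exp_le_exp.2 hlog
  rw [Real.exp_log hPpos, Real.exp_sub, Real.exp_log hgpos, div_eq_mul_inv, ← Real.exp_neg] at hexp
  calc Real.exp (-(E + j * R)) * scaledGauss d n p y
      = scaledGauss d n p y * Real.exp (-(j * R)) * Real.exp (-E) := by
        rw [neg_add, Real.exp_add]; ring
    _ ≤ scaledGauss d n p (castK d k) * Real.exp (-E) :=
        mul_le_mul_of_nonneg_right hgk (Real.exp_pos _).le
    _ ≤ _ := hexp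

/-- Comparison of the chi-square probability with the confidence sum for a count vector at
Mahalanobis distance at most `R` from the mean. -/
lemma regGamma_le_confSum_add {d n : ℕ} (hd : 0 < d) (hn : 0 < n) {p : Fin d → ℝ}
    (hp : p ∈ simplexInt d) {a R : ℝ} (ha : 0 < a) (hw : ∀ i, 1 ≤ n * a ^ 2 * extP d p i)
    (hR : 0 ≤ R) (haR : a * R ≤ 1 / 100) {nh : Fin d → ℕ} (hnh : ∑ i, nh i ≤ n)
    (hQ : quadForm d p (delVec d n p (castK d nh)) ≤ R ^ 2) :
    regGamma (d / 2) (quadForm d p (delVec d n p (castK d nh)) / 2) ≤ confSum d n p nh +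
      (2 * a * R ^ 3 + 2 * (d + 1) * a * R + (d + 1) * a ^ 2 +
        4 * (8 * a * R ^ 2 + 9 * a * (d + 1))) := by
  set Q := quadForm d p (delVec d n p (castK d nh)) with hQdef
  have hQ0 : 0 ≤ Q := by
    obtain ⟨B, hB⟩ := exists_precM_factor hp
    rw [hQdef, quadForm_eq_norm_sq hp hB]
    positivity
  set r := √Q with hr
  have hr0 : 0 ≤ r := Real.sqrt_nonneg _
  have hr2 : r ^ 2 = Q := Real.sq_sqrt hQ0
  have hrR : r ≤ R := Real.sqrt_le_iff.2 ⟨hR, hQ⟩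
  set s := a * (8 * R ^ 2 + 8 * (d + 1)) with hs
  set j := a * ((d : ℝ) + 1) with hj
  have hj0 : 0 ≤ j := by positivity
  have hs0 : 0 ≤ s := by positivity
  have hd0 : (0 : ℝ) ≤ d := by positivity
  have hE1 : 0 ≤ 2 * a * R ^ 3 + 2 * (d + 1) * a * R + (d + 1) * a ^ 2 := by positivity
  have hsj : 8 * a * R ^ 2 + 9 * a * (d + 1) = s + j := by rw [hs, hj]; ring
  rw [hsj, ← hr2]
  have hconf : 0 ≤ confSum d n p nh := by
    rw [confSum_eq]
    exact Finset.sum_nonneg fun k _ => multinomialPMF_nonneg hp k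
  rcases lt_or_ge r (s + j) with hlt | hge
  · have h := regGamma_half_sq_sub_le hd le_rfl hr0
    have h0 : regGamma ((d : ℝ) / 2) (0 ^ 2 / 2) = 0 := by simp [regGamma]
    rw [h0] at h
    linarith
  set ρ := r - s - j with hρ
  have hρ0 : 0 ≤ ρ := by linarith
  have hsub := exp_neg_mul_regGamma_le_sum (R := R) hd hn hp ha hw hρ0 (by linarith) haR
  have hρj : ρ + a * (d + 1) = r - s := by rw [hρ, hj]; ring
  rw [hρj] at hsub
  set S := (countBox d n).filter (fun k => ∑ i, k i ≤ n ∧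
        quadForm d p (delVec d n p (castK d k)) ≤ (r - s) ^ 2) with hS
  have hSP : ∀ k ∈ S, multinomialPMF d n p nh ≤ multinomialPMF d n p k := by
    intro k hk
    obtain ⟨-, hk1, hk2⟩ := Finset.mem_filter.1 hk
    have har : a * r ≤ 1 / 100 := (mul_le_mul_of_nonneg_left hrR ha.le).trans haR
    have hrs : (r - s) ^ 2 ≤ r ^ 2 := pow_le_pow_left₀ (by linarith) (by linarith) 2
    have e1 := (abs_le.1 (abs_log_multinomialPMF_sub_le hn hp ha hw hr0 har hk1
      (hk2.trans hrs))).1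
    have e2 := (abs_le.1 (abs_log_multinomialPMF_sub_le hn hp ha hw hr0 har hnh hr2.ge)).2
    have hlog : ∀ y, Real.log (scaledGauss d n p y) =
        -(quadForm d p (delVec d n p y) / 2) -
          Real.log √((2 * π * n) ^ d * ∏ i, extP d p i) := by
      intro y
      have hn' : (0 : ℝ) < n := by exact_mod_cast hn
      have : 0 < ∏ i, extP d p i := Finset.prod_pos fun i _ => extP_pos hp i
      rw [scaledGauss, Real.log_div (Real.exp_pos _).ne' (by positivity), Real.log_exp]
    rw [hlog] at e1 e2
    rw [← hQdef, ← hr2] at e2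
    refine (Real.log_le_log_iff (multinomialPMF_pos hp hnh) (multinomialPMF_pos hp hk1)).1 ?_
    have har2 : a ≤ s := by
      rw [hs]; nlinarith [sq_nonneg R, mul_nonneg ha.le hd0, mul_nonneg ha.le (sq_nonneg R)]
    have har3 : a ≤ r := by linarith
    have hkey : 2 * (2 * a * r ^ 3 + (d + 1) * a * r + (d + 1) * a ^ 2) ≤ s * r / 2 := by
      have h1 : a * r ^ 3 ≤ a * R ^ 2 * r := by
        have : r ^ 2 ≤ R ^ 2 := pow_le_pow_left₀ hr0 hrR 2
        nlinarith [mul_le_mul_of_nonneg_left this (mul_nonneg ha.le hr0)]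
      have h2 : (d + 1) * a ^ 2 ≤ (d + 1) * a * r := by
        have := mul_le_mul_of_nonneg_left har3 (show 0 ≤ ((d : ℝ) + 1) * a by positivity)
        linarith
      rw [hs]
      linarith
    have hq : s * r ≤ r ^ 2 - (r - s) ^ 2 := by nlinarith
    linarith
  have hle := hsub.trans (sum_le_confSum hp nh hSP (Finset.filter_subset _ _))
  have hgam := regGamma_half_sq_sub_le hd hρ0 (show ρ ≤ r by linarith)
  have hone := regGamma_le_one (show 0 < (d : ℝ) / 2 by positivity)
    (show 0 ≤ ρ ^ 2 / 2 by positivity)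
  set E := 2 * a * R ^ 3 + (d + 1) * a * R + (d + 1) * a ^ 2 + a * (d + 1) * R with hE
  have hE0 : 0 ≤ E := by positivity
  have hexp : 1 - E ≤ Real.exp (-E) := by linarith [Real.add_one_le_exp (-E)]
  have hg : regGamma (d / 2) (ρ ^ 2 / 2) - E ≤ Real.exp (-E) * regGamma (d / 2) (ρ ^ 2 / 2) := by
    set G := regGamma (d / 2) (ρ ^ 2 / 2) with hG
    have hexp1 : Real.exp (-E) ≤ 1 := Real.exp_le_one_iff.2 (neg_nonpos.2 hE0)
    have h3 : 0 ≤ (1 - Real.exp (-E)) * (1 - G) :=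
      mul_nonneg (by linarith) (by linarith)
    linarith
  have hEE : E = 2 * a * R ^ 3 + 2 * (d + 1) * a * R + (d + 1) * a ^ 2 := by rw [hE]; ring
  linarith

lemma extP_div_eq {d n : ℕ} (hn : 0 < n) {nh : Fin d → ℕ} (hnh : ∑ i, nh i ≤ n)
    (i : Fin (d + 1)) : extP d (fun i => (nh i : ℝ) / n) i = extK d n nh i / n := by
  have hn' : (n : ℝ) ≠ 0 := by exact_mod_cast hn.ne'
  refine Fin.lastCases ?_ (fun j => ?_) i
  · simp only [extP, extK, Fin.snoc_last, Nat.cast_sub hnh, ← Finset.sum_div]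
    push_cast
    field_simp
  · simp [extP, extK]

/-- The quadratic form at a count vector is `n` times a chi-square divergence. -/
lemma quadForm_delVec_castK {d n : ℕ} (hn : 0 < n) {p : Fin d → ℝ} (hp : p ∈ simplexInt d)
    {nh : Fin d → ℕ} (hnh : ∑ i, nh i ≤ n) :
    quadForm d p (delVec d n p (castK d nh)) = n * ∑ i,
      (extP d (fun i => (nh i : ℝ) / n) i - extP d p i) ^ 2 / extP d p i := by
  have hn' : (n : ℝ) ≠ 0 := by exact_mod_cast hn.ne'
  rw [quadForm_delVec hn hp, Finset.mul_sum]
  refine Finset.sum_congr rfl fun i _ => ?_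
  have h2 : (extK d n nh i : ℝ) = n * extP d (fun i => (nh i : ℝ) / n) i := by
    rw [extP_div_eq hn hnh]
    exact (mul_div_cancel₀ _ hn').symm
  rw [extV_castK hnh, h2, ← mul_sub, mul_pow, sq (n : ℝ), mul_assoc,
    mul_div_mul_left _ _ hn', mul_div_assoc]

/-- The relative entropy bound for the multinomial probability of an observed count. -/
lemma multinomialPMF_le_exp_neg {d n : ℕ} (hn : 0 < n) {p : Fin d → ℝ} (hp : p ∈ simplexInt d)
    {nh : Fin d → ℕ} (hnh : ∑ i, nh i ≤ n)
    (hq : (fun i => (nh i : ℝ) / n) ∈ simplexInt d) :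
    multinomialPMF d n p nh ≤ Real.exp (-(n * ∑ i, extP d (fun i => (nh i : ℝ) / n) i *
      Real.log (extP d (fun i => (nh i : ℝ) / n) i / extP d p i))) := by
  have hn' : (0 : ℝ) < n := by exact_mod_cast hn
  have h1 := multinomialPMF_le_one (n := n) hq nh
  have hpos := multinomialPMF_pos hq hnh
  have hpos' := multinomialPMF_pos hp hnh
  set q := extP d (fun i => (nh i : ℝ) / n) with hqdef
  have hqK : ∀ i, q i = extK d n nh i / n := extP_div_eq hn hnh
  rw [← Real.log_le_iff_le_exp hpos']
  have hlog : ∀ p' : Fin d → ℝ, p' ∈ simplexInt d → Real.log (multinomialPMF d n p' nh) =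
      Real.log ((n.factorial : ℝ) / ∏ i, ((extK d n nh i).factorial : ℝ)) +
        ∑ i, extK d n nh i * Real.log (extP d p' i) := by
    intro p' hp'
    rw [multinomialPMF_eq p' hnh, Real.log_mul, Real.log_prod]
    · congr 1
      exact Finset.sum_congr rfl fun i _ => Real.log_pow _ _
    · exact fun i _ => pow_ne_zero _ (extP_pos hp' i).ne'
    · exact div_ne_zero (by positivity) (Finset.prod_ne_zero_iff.2 fun i _ => by positivity)
    · exact Finset.prod_ne_zero_iff.2 fun i _ => pow_ne_zero _ (extP_pos hp' i).ne'
  have h2 : Real.log (multinomialPMF d n (fun i => (nh i : ℝ) / n) nh) ≤ 0 :=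
    Real.log_nonpos hpos.le h1
  rw [hlog _ hq] at h2
  rw [hlog _ hp]
  have h3 : n * ∑ i, q i * Real.log (q i / extP d p i) =
      ∑ i, extK d n nh i * Real.log (q i) - ∑ i, extK d n nh i * Real.log (extP d p i) := by
    rw [Finset.mul_sum, ← Finset.sum_sub_distrib]
    refine Finset.sum_congr rfl fun i _ => ?_
    rw [Real.log_div (extP_pos hq i).ne' (extP_pos hp i).ne', ← mul_assoc]
    have : n * q i = extK d n nh i := by rw [hqK]; field_simp
    rw [this]; ring
  rw [h3]
  linarith

/-- If the relative entropy of the observed frequencies is large, then the confidence sum is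
close to one. -/
lemma one_sub_inv_le_confSum {d n : ℕ} (hn : 3 ≤ n) {p : Fin d → ℝ} (hp : p ∈ simplexInt d)
    {nh : Fin d → ℕ} (hnh : ∑ i, nh i ≤ n)
    (hq : (fun i => (nh i : ℝ) / n) ∈ simplexInt d)
    (hfar : 2 * ((d : ℝ) + 1) * Real.log n / n ≤
      ∑ i, extP d (fun i => (nh i : ℝ) / n) i *
        Real.log (extP d (fun i => (nh i : ℝ) / n) i / extP d p i)) :
    1 - (n : ℝ)⁻¹ ≤ confSum d n p nh := by
  have hn3 : (3 : ℝ) ≤ n := by exact_mod_cast hn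
  have hn' : (0 : ℝ) < n := by linarith
  have hL : 0 ≤ Real.log n := Real.log_nonneg (by linarith)
  have hexpL : Real.exp (Real.log n) = n := Real.exp_log hn'
  set L := Real.log n
  have hP2 : multinomialPMF d n p nh ≤ Real.exp (-(2 * (d + 1) * L)) := by
    refine (multinomialPMF_le_exp_neg (by omega) hp hnh hq).trans
      (Real.exp_le_exp.2 (neg_le_neg ?_))
    rwa [div_le_iff₀' hn'] at hfar
  have hn2 : ((n : ℝ) + 1) ^ d ≤ Real.exp (d * (2 * L)) := by
    have h1 : (n : ℝ) + 1 ≤ Real.exp (2 * L) := by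
      rw [two_mul, Real.exp_add, hexpL]
      nlinarith
    rw [Real.exp_nat_mul]
    exact pow_le_pow_left₀ (by linarith) h1 d
  have h3 : ((n : ℝ) + 1) ^ d * multinomialPMF d n p nh ≤ (n : ℝ)⁻¹ := by
    calc _ ≤ Real.exp (d * (2 * L)) * Real.exp (-(2 * (d + 1) * L)) :=
          mul_le_mul hn2 hP2 (multinomialPMF_nonneg hp _) (Real.exp_pos _).le
      _ = Real.exp (-L + -L) := by
          rw [← Real.exp_add]
          congr 1
          ring
      _ ≤ Real.exp (-L) := Real.exp_le_exp.2 (by linarith)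
      _ = (n : ℝ)⁻¹ := by rw [Real.exp_neg, hexpL]
  have h9 := one_sub_le_confSum (n := n) hp nh
  linarith

/-- If the relative entropy of `q` with respect to `w` is small, then `w` is bounded below and
the chi-square divergence is comparable to the relative entropy. -/
lemma chi_sq_le_of_relEntropy_le {ι : Type*} [Fintype ι] {q w : ι → ℝ} {τ c : ℝ}
    (hq : ∀ i, 0 < q i) (hw : ∀ i, 0 < w i) (hqs : ∑ i, q i = 1) (hws : ∑ i, w i = 1)
    (hτ : ∀ i, (q i)⁻¹ ≤ τ) (hc : ∑ i, q i * Real.log (q i / w i) ≤ c) (hτc : τ * c ≤ 1 / 361) :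
    (∀ i, 1 ≤ 2 * τ * w i) ∧ ∑ i, (q i - w i) ^ 2 / w i ≤ 9 / 2 * c := by
  set h : ι → ℝ := fun i => √(w i / q i) with hh
  have hpos : ∀ i, 0 < h i := fun i => Real.sqrt_pos.2 (div_pos (hw i) (hq i))
  have hwq : ∀ i, w i = q i * h i ^ 2 := fun i => by
    have := (hq i).ne'
    rw [hh, Real.sq_sqrt (div_pos (hw i) (hq i)).le]; field_simp
  have hell : ∑ i, q i * (1 - h i) ^ 2 ≤ c := by
    have h1 : ∑ i, q i * (1 - h i) ^ 2 = ∑ i, q i * (2 * (1 - h i)) := by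
      have h2 : ∀ i, q i * (1 - h i) ^ 2 = q i * (2 * (1 - h i)) + (w i - q i) := by
        intro i; rw [hwq i]; ring
      simp_rw [h2, Finset.sum_add_distrib, Finset.sum_sub_distrib, hqs, hws]
      ring
    rw [h1]
    refine le_trans (Finset.sum_le_sum fun i _ => ?_) hc
    refine mul_le_mul_of_nonneg_left ?_ (hq i).le
    have h3 : Real.log (q i / w i) = -(2 * Real.log (h i)) := by
      rw [hh, Real.log_sqrt (div_pos (hw i) (hq i)).le, ← inv_div, Real.log_inv]; ring
    have := Real.log_le_sub_one_of_pos (hpos i)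
    rw [h3]; linarith
  have hi : ∀ i, (18 / 19 : ℝ) ≤ h i := by
    intro i
    have h1 := (Finset.single_le_sum (f := fun i => q i * (1 - h i) ^ 2)
      (fun j _ => mul_nonneg (hq j).le (sq_nonneg _)) (Finset.mem_univ i)).trans hell
    have h2 : 1 ≤ τ * q i := by
      have := mul_le_mul_of_nonneg_right (hτ i) (hq i).le
      rwa [inv_mul_cancel₀ (hq i).ne'] at this
    have hτ0 : 0 ≤ τ := (inv_pos.2 (hq i)).le.trans (hτ i)
    have h3 : (1 - h i) ^ 2 ≤ (1 / 19) ^ 2 := by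
      calc (1 - h i) ^ 2 ≤ τ * q i * (1 - h i) ^ 2 := le_mul_of_one_le_left (sq_nonneg _) h2
        _ = τ * (q i * (1 - h i) ^ 2) := by ring
        _ ≤ τ * c := mul_le_mul_of_nonneg_left h1 hτ0
        _ ≤ _ := by linarith
    have := (abs_le.1 (abs_le_of_sq_le_sq h3 (by norm_num))).2
    linarith
  constructor
  · intro i
    have h2 : 1 ≤ τ * q i := by
      have := mul_le_mul_of_nonneg_right (hτ i) (hq i).le
      rwa [inv_mul_cancel₀ (hq i).ne'] at this
    have h3 : 1 / 2 ≤ h i ^ 2 := by nlinarith [hi i]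
    rw [hwq i]
    nlinarith
  · calc ∑ i, (q i - w i) ^ 2 / w i ≤ ∑ i, 9 / 2 * (q i * (1 - h i) ^ 2) := by
          refine Finset.sum_le_sum fun i _ => ?_
          rw [div_le_iff₀ (hw i), hwq i]
          have h4 : (1 + h i) ^ 2 ≤ 9 / 2 * h i ^ 2 := by nlinarith [hi i]
          calc (q i - q i * h i ^ 2) ^ 2 = q i ^ 2 * (1 - h i) ^ 2 * (1 + h i) ^ 2 := by ring
            _ ≤ q i ^ 2 * (1 - h i) ^ 2 * (9 / 2 * h i ^ 2) :=
              mul_le_mul_of_nonneg_left h4 (by positivity)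
            _ = _ := by ring
      _ = 9 / 2 * ∑ i, q i * (1 - h i) ^ 2 := by rw [Finset.mul_sum]
      _ ≤ _ := by linarith

/-- The numerical comparison of the accumulated errors, in terms of `θ = √τ`, `δ = √(d + 1)`,
`l = √(log n)` and `ν = 1 / √n`. -/
lemma error_le_of_one_le {θ δ l ν : ℝ} (hδ : 1 ≤ δ) (hδθ : δ ≤ θ) (hl : 1 ≤ l) (hν : 0 ≤ ν)
    (hν1 : ν ≤ 1) :
    2 * (3 / 2 * θ * ν) * (3 * δ * l) ^ 3 + 2 * δ ^ 2 * (3 / 2 * θ * ν) * (3 * δ * l) +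
        δ ^ 2 * (3 / 2 * θ * ν) ^ 2 +
        4 * (8 * (3 / 2 * θ * ν) * (3 * δ * l) ^ 2 + 9 * (3 / 2 * θ * ν) * δ ^ 2) ≤
      600 * (θ ^ 2 * δ ^ 2 * l ^ 3 * ν) ∧
    3 / 2 * θ * ν * (3 * δ * l) ≤ 9 / 2 * (θ ^ 2 * δ ^ 2 * l ^ 3 * ν) ∧
    θ ^ 2 * δ ^ 2 * l ^ 2 * ν ^ 2 ≤ θ ^ 2 * δ ^ 2 * l ^ 3 * ν := by
  have hδ0 : 0 < δ := by linarith
  have hθ : 1 ≤ θ := by linarith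
  have hθ0 : 0 < θ := by linarith
  have hl0 : 0 < l := by linarith
  have hl2 : 1 ≤ l ^ 2 := one_le_pow₀ hl
  have hl3 : 1 ≤ l ^ 3 := one_le_pow₀ hl
  have hl23 : l ^ 2 ≤ l ^ 3 := pow_le_pow_right₀ hl (by norm_num)
  have hl13 : l ≤ l ^ 3 := le_self_pow₀ hl (by norm_num)
  have hθ2 : θ ≤ θ ^ 2 := le_self_pow₀ hθ (by norm_num)
  have hδ2 : δ ≤ δ ^ 2 := le_self_pow₀ hδ (by norm_num)
  have hδθ' : θ * δ ≤ θ ^ 2 := by nlinarith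
  have hν2 : ν ^ 2 ≤ ν := by nlinarith
  have e1 : θ * δ ^ 3 * l ^ 3 * ν ≤ θ ^ 2 * δ ^ 2 * l ^ 3 * ν := by
    calc θ * δ ^ 3 * l ^ 3 * ν = (θ * δ) * δ ^ 2 * l ^ 3 * ν := by ring
      _ ≤ _ := by gcongr
  have e2 : θ * δ ^ 3 * l * ν ≤ θ ^ 2 * δ ^ 2 * l ^ 3 * ν := by
    calc θ * δ ^ 3 * l * ν = (θ * δ) * δ ^ 2 * l * ν := by ring
      _ ≤ _ := by gcongr
  have e3 : θ ^ 2 * δ ^ 2 * 1 * ν ^ 2 ≤ θ ^ 2 * δ ^ 2 * l ^ 3 * ν := by gcongr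
  have e4 : θ * δ ^ 2 * l ^ 2 * ν ≤ θ ^ 2 * δ ^ 2 * l ^ 3 * ν := by gcongr
  have e5 : θ * δ ^ 2 * 1 * ν ≤ θ ^ 2 * δ ^ 2 * l ^ 3 * ν := by gcongr
  have e6 : θ * δ * l * ν ≤ θ ^ 2 * δ ^ 2 * l ^ 3 * ν := by gcongr
  have e7 : θ ^ 2 * δ ^ 2 * l ^ 2 * ν ^ 2 ≤ θ ^ 2 * δ ^ 2 * l ^ 3 * ν := by gcongr
  have hu : 0 ≤ θ ^ 2 * δ ^ 2 * l ^ 3 * ν := by positivity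
  exact ⟨by linarith, by linarith, e7⟩

/-- The chi-square probability exceeds the confidence sum by at most the stated error. -/
lemma regGamma_le_confSum {d n : ℕ} {τ : ℝ} (hd : 0 < d) (hτ : (d : ℝ) + 1 ≤ τ)
    (hn : τ ^ 4 ≤ (n : ℝ)) {nh : Fin d → ℕ} (hnh : ∑ i, nh i ≤ n)
    (hphat : (fun i => (nh i : ℝ) / n) ∈ Ptau d τ) {p : Fin d → ℝ} (hp : p ∈ simplexInt d) :
    regGamma ((d : ℝ) / 2) (quadForm d p (delVec d n p (castK d nh)) / 2) ≤ confSum d n p nh +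
      194.96 * τ ^ 3 * ((d : ℝ) + 1) * Real.log n ^ ((3 : ℝ) / 2) / (n : ℝ) ^ ((1 : ℝ) / 2) := by
  have hd1 : (1 : ℝ) ≤ d := by exact_mod_cast hd
  have hτ2 : 2 ≤ τ := by linarith
  have hn16 : (16 : ℝ) ≤ n := by
    have : (2 : ℝ) ^ 4 ≤ τ ^ 4 := pow_le_pow_left₀ (by norm_num) hτ2 4
    linarith
  have hn' : (0 : ℝ) < n := by linarith
  have hn0 : 0 < n := by exact_mod_cast hn'
  have hL : 1 ≤ Real.log n := by
    rw [Real.le_log_iff_exp_le hn']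
    linarith [Real.exp_one_lt_d9]
  set L := Real.log n with hLdef
  set θ := √τ with hθ
  set δ := √((d : ℝ) + 1) with hδ
  set l := √L with hl
  set ν := 1 / √(n : ℝ) with hν
  have hθ2 : θ ^ 2 = τ := Real.sq_sqrt (by linarith)
  have hδ2 : δ ^ 2 = d + 1 := Real.sq_sqrt (by linarith)
  have hl2 : l ^ 2 = L := Real.sq_sqrt (by linarith)
  have hν2 : ν ^ 2 = 1 / n := by rw [hν, div_pow, Real.sq_sqrt hn'.le, one_pow]
  have hsn : 1 ≤ √(n : ℝ) := Real.one_le_sqrt.2 (by linarith)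
  have hν0 : 0 < ν := by positivity
  have hν1 : ν ≤ 1 := by rw [hν, div_le_one (by linarith)]; exact hsn
  have hδ1 : 1 ≤ δ := Real.one_le_sqrt.2 (by linarith)
  have hδθ : δ ≤ θ := Real.sqrt_le_sqrt hτ
  have hl1 : 1 ≤ l := Real.one_le_sqrt.2 hL
  have hε : 194.96 * τ ^ 3 * ((d : ℝ) + 1) * L ^ ((3 : ℝ) / 2) / (n : ℝ) ^ ((1 : ℝ) / 2) =
      194.96 * τ ^ 2 * (θ ^ 2 * δ ^ 2 * l ^ 3 * ν) := by
    have h1 : L ^ ((3 : ℝ) / 2) = l ^ 3 := by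
      rw [hl, Real.sqrt_eq_rpow, ← Real.rpow_natCast, ← Real.rpow_mul (by linarith)]
      norm_num
    rw [h1, ← Real.sqrt_eq_rpow, hθ2, hδ2, hν]
    ring
  rw [hε]
  obtain ⟨e1, e2, e3⟩ := error_le_of_one_le hδ1 hδθ hl1 hν0.le hν1
  set u := θ ^ 2 * δ ^ 2 * l ^ 3 * ν with hu
  have hu0 : 0 ≤ u := by positivity
  have hεu : 779 * u ≤ 194.96 * τ ^ 2 * u :=
    mul_le_mul_of_nonneg_right (by nlinarith) hu0
  have hQ0 : 0 ≤ quadForm d p (delVec d n p (castK d nh)) := by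
    obtain ⟨B, hB⟩ := exists_precM_factor hp
    rw [quadForm_eq_norm_sq hp hB]
    positivity
  have hone := regGamma_le_one (show 0 < (d : ℝ) / 2 by positivity)
    (show 0 ≤ quadForm d p (delVec d n p (castK d nh)) / 2 by positivity)
  have hconf : 0 ≤ confSum d n p nh := by
    rw [confSum_eq]
    exact Finset.sum_nonneg fun k _ => multinomialPMF_nonneg hp k
  rcases le_or_gt 1 (779 * u) with hbig | hsmall
  · linarith
  set q := extP d (fun i => (nh i : ℝ) / n) with hq
  set w := extP d p with hw
  set c := 2 * (d + 1) * L / n with hc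
  rcases le_or_gt (∑ i, q i * Real.log (q i / w i)) c with hnear | hfar
  · have hτc : τ * c = 2 * (θ ^ 2 * δ ^ 2 * l ^ 2 * ν ^ 2) := by
      rw [hc, hθ2, hδ2, hl2, hν2]; ring
    obtain ⟨hw2, hchi⟩ := chi_sq_le_of_relEntropy_le (extP_pos hphat.1) (extP_pos hp)
      (sum_extP d _) (sum_extP d p) hphat.2 hnear (by linarith)
    have hQ : quadForm d p (delVec d n p (castK d nh)) ≤ (3 * δ * l) ^ 2 := by
      rw [quadForm_delVec_castK hn0 hp hnh]
      have h4 := mul_le_mul_of_nonneg_left hchi hn'.le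
      have h5 : n * (9 / 2 * c) = (3 * δ * l) ^ 2 := by
        rw [mul_pow, mul_pow, hδ2, hl2, hc]; field_simp; ring
      linarith
    have hmain := regGamma_le_confSum_add (a := 3 / 2 * θ * ν) (R := 3 * δ * l) hd hn0 hp
      (by positivity)
      (by
        intro i
        have h1 : n * (3 / 2 * θ * ν) ^ 2 * extP d p i = 9 / 4 * τ * extP d p i := by
          rw [mul_pow, mul_pow, hθ2, hν2]; field_simp; ring
        rw [h1]
        have := hw2 i
        linarith)
      (by positivity) (by linarith) hnh hQ
    rw [← hδ2] at hmain
    linarith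
  · have h3 := one_sub_inv_le_confSum (show 3 ≤ n by exact_mod_cast (by linarith : (3 : ℝ) ≤ n))
      hp hnh hphat.1 hfar.le
    rw [← one_div, ← hν2] at h3
    have hνν : ν ^ 2 ≤ ν := by nlinarith
    have h4 : ν ≤ u := by
      have h5 : 1 ≤ θ ^ 2 * δ ^ 2 * l ^ 3 := by
        have h6 : 1 ≤ θ ^ 2 := one_le_pow₀ (hδ1.trans hδθ)
        have h7 : 1 ≤ δ ^ 2 := one_le_pow₀ hδ1
        have h8 : 1 ≤ l ^ 3 := one_le_pow₀ hl1
        exact one_le_mul_of_one_le_of_one_le (one_le_mul_of_one_le_of_one_le h6 h7) h8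
      exact le_mul_of_one_le_left hν0.le h5
    linarith

/-- **Proposition 3 (inclusion of the exact confidence set in the Gaussian one).** -/
theorem stmt5 (d : ℕ) (τ α : ℝ) (hτ : (d : ℝ) + 1 ≤ τ) (hα : α ∈ Set.Ioo (0 : ℝ) 1)
    (n : ℕ) (hn : τ ^ 4 ≤ (n : ℝ)) (nh : Fin d → ℕ)
    (hpos : ∀ i, 0 < nh i) (hsum : ∑ i, nh i < n)
    (hphat : (fun i => (nh i : ℝ) / n) ∈ Ptau d τ) :
    exactCS d n nh α ⊆
      gaussCS d n nh
        (α - 194.96 * τ ^ 3 * ((d : ℝ) + 1) * Real.log n ^ ((3 : ℝ) / 2) /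
          (n : ℝ) ^ ((1 : ℝ) / 2)) := by
  rintro p ⟨hp, hconf⟩
  refine ⟨hp, ?_⟩
  rcases Nat.eq_zero_or_pos d with rfl | hd
  · have hn1 : (1 : ℝ) ≤ n := by exact_mod_cast (show 1 ≤ n by omega)
    have hτ0 : 0 ≤ τ := by push_cast at hτ; linarith
    have hlog := Real.log_nonneg hn1
    have hε : 0 ≤ 194.96 * τ ^ 3 * (((0 : ℕ) : ℝ) + 1) * Real.log n ^ ((3 : ℝ) / 2) /
        (n : ℝ) ^ ((1 : ℝ) / 2) := by positivity
    rw [Nat.cast_zero, zero_div, regGamma_zero_left, ← Nat.cast_zero (R := ℝ)]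
    linarith [hα.2]
  · linarith [regGamma_le_confSum hd hτ hn hsum.le hphat hp]
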